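/- arXiv:2405.00756 — 6 statements merged into one kernel-verified Lean document; each statement's English description precedes it below -/
import Mathlib

section
/- Let λ be a partition of n and T ∈ RYT(λ). Then the fiber PSYT(λ;T) contains a unique element Min(T) and a unique element Top(T) such that Min(T) ≤ τ ≤ Top(T) for every τ ∈ PSYT(λ;T), where ≤ is the partial order on PSYT(λ). -/
open scoped Classical

/-- The content of a box `(i, j)` (row `i`, column `j`, both 0-indexed): `c(□) = j - i`. -/
def content (c : ℕ × ℕ) : ℤ := (c.2 : ℤ) - (c.1 : ℤ)

/-- The order on the formal labels `j·q^b` (encoded as pairs `(j, b)`):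
`j·q^m < k·q^ℓ` iff `m > ℓ`, or `m = ℓ` and `j < k`. -/
def labelLT (x y : ℕ × ℕ) : Prop := y.2 < x.2 ∨ (x.2 = y.2 ∧ x.1 < y.1)

/-- `τ` is a (non-negative) periodic standard Young tableau on the finite cell set `s`
(a labelling of the boxes by symbols `j·q^b`, encoded as pairs `(j, b)`): each number
`1 ≤ j ≤ s.card` occurs in exactly one box, the labels strictly increase along rows and
columns, and `τ` is normalized to `(0, 0)` off `s`. -/
def IsPSYT (s : Finset (ℕ × ℕ)) (τ : ℕ × ℕ → ℕ × ℕ) : Prop :=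
  (∀ j, 1 ≤ j → j ≤ s.card → ∃! c, c ∈ s ∧ (τ c).1 = j) ∧
  (∀ c ∈ s, ∀ c' ∈ s, c.1 = c'.1 → c.2 + 1 = c'.2 → labelLT (τ c) (τ c')) ∧
  (∀ c ∈ s, ∀ c' ∈ s, c.1 + 1 = c'.1 → c.2 = c'.2 → labelLT (τ c) (τ c')) ∧
  (∀ c, c ∉ s → τ c = (0, 0))

/-- `T` is a non-negative reverse Young tableau on `s`: entries weakly decrease along rows
and down columns (normalized to `0` off `s`). -/
def IsRYT (s : Finset (ℕ × ℕ)) (T : ℕ × ℕ → ℕ) : Prop :=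
  (∀ c ∈ s, ∀ c' ∈ s, c.1 = c'.1 → c.2 + 1 = c'.2 → T c' ≤ T c) ∧
  (∀ c ∈ s, ∀ c' ∈ s, c.1 + 1 = c'.1 → c.2 = c'.2 → T c' ≤ T c) ∧
  (∀ c, c ∉ s → T c = 0)

/-- `T` is a non-negative reverse semi-standard Young tableau on `s`: entries weakly
decrease along rows and strictly decrease down columns (normalized to `0` off `s`). -/
def IsRSSYT (s : Finset (ℕ × ℕ)) (T : ℕ × ℕ → ℕ) : Prop :=
  (∀ c ∈ s, ∀ c' ∈ s, c.1 = c'.1 → c.2 + 1 = c'.2 → T c' ≤ T c) ∧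
  (∀ c ∈ s, ∀ c' ∈ s, c.1 + 1 = c'.1 → c.2 = c'.2 → T c' < T c) ∧
  (∀ c, c ∉ s → T c = 0)

/-- `τ ∈ PSYT(λ; T)`: a periodic standard Young tableau whose `q`-exponents are given
by `T`. -/
def InFiber (s : Finset (ℕ × ℕ)) (T : ℕ × ℕ → ℕ) (τ : ℕ × ℕ → ℕ × ℕ) : Prop :=
  IsPSYT s τ ∧ ∀ c ∈ s, (τ c).2 = T c

/-- Column-standard reading order on boxes: columns left to right, each column top to
bottom. -/
def colReadLT (c c' : ℕ × ℕ) : Prop := c.2 < c'.2 ∨ (c.2 = c'.2 ∧ c.1 < c'.1)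

/-- Row-standard reading order on boxes: rows top to bottom, left to right in each row. -/
def rowReadLT (c c' : ℕ × ℕ) : Prop := c.1 < c'.1 ∨ (c.1 = c'.1 ∧ c.2 < c'.2)

/-- The box order `□ <_T □'`: `T □ > T □'`, or `T □ = T □'` and `□` precedes `□'` in the
column-standard reading order. -/
def boxLT (T : ℕ × ℕ → ℕ) (c c' : ℕ × ℕ) : Prop :=
  T c' < T c ∨ (T c = T c' ∧ colReadLT c c')

/-- The set `Inv(τ)` of inversion pairs of `τ` (with `q`-exponents `T`): ordered pairs of
boxes `(□₁, □₂)` with `□₁ <_T □₂` whose number labels are in decreasing order. -/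
noncomputable def invSet (s : Finset (ℕ × ℕ)) (T : ℕ × ℕ → ℕ) (τ : ℕ × ℕ → ℕ × ℕ) :
    Finset ((ℕ × ℕ) × (ℕ × ℕ)) :=
  (s ×ˢ s).filter fun p => boxLT T p.1 p.2 ∧ (τ p.2).1 < (τ p.1).1

/-- `inv(τ) = |Inv(τ)|`. -/
noncomputable def invNum (s : Finset (ℕ × ℕ)) (T : ℕ × ℕ → ℕ) (τ : ℕ × ℕ → ℕ × ℕ) : ℕ :=
  (invSet s T τ).card

/-- The auxiliary reading order used to define `Min(T)`: boxes with smaller `T`-value come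
first, boxes of equal `T`-value in row-standard reading order. -/
def minOrd (T : ℕ × ℕ → ℕ) (c c' : ℕ × ℕ) : Prop :=
  T c < T c' ∨ (T c = T c' ∧ rowReadLT c c')

/-- The tableau `Min(T) ∈ PSYT(λ;T)`: `q`-exponents given by `T`, numbers `1, …, n`
assigned so that boxes with larger `T`-value receive larger numbers, boxes of equal
`T`-value being numbered consecutively in row-standard reading order. -/
noncomputable def minTab (s : Finset (ℕ × ℕ)) (T : ℕ × ℕ → ℕ) : ℕ × ℕ → ℕ × ℕ :=
  fun c => if c ∈ s then ((s.filter fun c' => minOrd T c' c).card + 1, T c) else (0, 0)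

/-- The (unique) box of `s` carrying the number `j` in the tableau `τ`. -/
noncomputable def theBox (s : Finset (ℕ × ℕ)) (τ : ℕ × ℕ → ℕ × ℕ) (j : ℕ) : ℕ × ℕ :=
  if h : ∃ c, c ∈ s ∧ (τ c).1 = j then h.choose else (0, 0)

/-- `w_τ(j)`: the `q`-exponent of the label containing the number `j`. -/
noncomputable def wOf (s : Finset (ℕ × ℕ)) (τ : ℕ × ℕ → ℕ × ℕ) (j : ℕ) : ℕ :=
  (τ (theBox s τ j)).2

/-- `c_τ(j)`: the content of the box whose label contains the number `j`. -/
noncomputable def cOf (s : Finset (ℕ × ℕ)) (τ : ℕ × ℕ → ℕ × ℕ) (j : ℕ) : ℤ :=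
  content (theBox s τ j)

/-- The operation `Ψ`: each label `k·q^a` with `k ≥ 2` becomes `(k-1)·q^a`, and the label
`1·q^a` becomes `n·q^(a+1)`. -/
def psiTab (s : Finset (ℕ × ℕ)) (τ : ℕ × ℕ → ℕ × ℕ) : ℕ × ℕ → ℕ × ℕ :=
  fun c => if c ∈ s then
    (if (τ c).1 = 1 then (s.card, (τ c).2 + 1) else ((τ c).1 - 1, (τ c).2))
  else (0, 0)

/-- The labelling obtained from `τ` by exchanging the numbers `i` and `i + 1` (keeping the
`q`-exponents attached to the boxes). -/
def swapNum (τ : ℕ × ℕ → ℕ × ℕ) (i : ℕ) : ℕ × ℕ → ℕ × ℕ :=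
  fun c => if (τ c).1 = i then (i + 1, (τ c).2)
    else if (τ c).1 = i + 1 then (i, (τ c).2) else τ c

/-- The cover relations on `PSYT(λ)`: `τ < Ψ(τ)`; `τ < s_i(τ)` whenever
`w_τ(i) < w_τ(i+1)`; and `τ < s_i(τ)` whenever `w_τ(i) = w_τ(i+1)` and
`c_τ(i) − c_τ(i+1) > 1`. -/
def psytCover (s : Finset (ℕ × ℕ)) (τ σ : ℕ × ℕ → ℕ × ℕ) : Prop :=
  IsPSYT s τ ∧ IsPSYT s σ ∧
    (σ = psiTab s τ ∨
      ∃ i, 1 ≤ i ∧ i + 1 ≤ s.card ∧ σ = swapNum τ i ∧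
        (wOf s τ i < wOf s τ (i + 1) ∨
          (wOf s τ i = wOf s τ (i + 1) ∧ 1 < cOf s τ i - cOf s τ (i + 1))))

/-- The partial order `≤` on `PSYT(λ)` generated by the cover relations. -/
def psytLE (s : Finset (ℕ × ℕ)) : (ℕ × ℕ → ℕ × ℕ) → (ℕ × ℕ → ℕ × ℕ) → Prop :=
  Relation.ReflTransGen (psytCover s)

lemma labelLT_trans {x y z : ℕ × ℕ} (h₁ : labelLT x y) (h₂ : labelLT y z) : labelLT x z := by
  unfold labelLT at *; omega

lemma IsPSYT.eq_of_fst_eq {s : Finset (ℕ × ℕ)} {τ : ℕ × ℕ → ℕ × ℕ} (h : IsPSYT s τ) {c d : ℕ × ℕ}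
    (hc : c ∈ s) (hd : d ∈ s) (hcd : (τ c).1 = (τ d).1) (h1 : 1 ≤ (τ c).1)
    (hn : (τ c).1 ≤ s.card) : c = d :=
  (h.1 _ h1 hn).unique ⟨hc, rfl⟩ ⟨hd, hcd.symm⟩

/-- The numbers of a periodic standard tableau are exactly `1, …, n`. -/
lemma IsPSYT.image_fst {s : Finset (ℕ × ℕ)} {τ : ℕ × ℕ → ℕ × ℕ} (h : IsPSYT s τ) :
    s.image (fun c => (τ c).1) = Finset.Icc 1 s.card := by
  symm
  apply Finset.eq_of_subset_of_card_le
  · intro j hj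
    rw [Finset.mem_Icc] at hj
    obtain ⟨c, ⟨hc, hcj⟩, -⟩ := h.1 j hj.1 hj.2
    exact Finset.mem_image.2 ⟨c, hc, hcj⟩
  · simpa using Finset.card_image_le

lemma IsPSYT.fst_mem {s : Finset (ℕ × ℕ)} {τ : ℕ × ℕ → ℕ × ℕ} (h : IsPSYT s τ) {c : ℕ × ℕ}
    (hc : c ∈ s) : 1 ≤ (τ c).1 ∧ (τ c).1 ≤ s.card := by
  rw [← Finset.mem_Icc, ← h.image_fst]
  exact Finset.mem_image_of_mem _ hc

lemma IsPSYT.injOn_fst {s : Finset (ℕ × ℕ)} {τ : ℕ × ℕ → ℕ × ℕ} (h : IsPSYT s τ) :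
    Set.InjOn (fun c => (τ c).1) s := fun _ hc _ hd hcd =>
  h.eq_of_fst_eq hc hd hcd (h.fst_mem hc).1 (h.fst_mem hc).2

lemma IsPSYT.theBox_spec {s : Finset (ℕ × ℕ)} {τ : ℕ × ℕ → ℕ × ℕ} (h : IsPSYT s τ) {j : ℕ}
    (h1 : 1 ≤ j) (hn : j ≤ s.card) : theBox s τ j ∈ s ∧ (τ (theBox s τ j)).1 = j := by
  have hex := (h.1 j h1 hn).exists
  unfold theBox
  rw [dif_pos hex]
  exact hex.choose_spec

lemma IsPSYT.theBox_eq {s : Finset (ℕ × ℕ)} {τ : ℕ × ℕ → ℕ × ℕ} (h : IsPSYT s τ) {c : ℕ × ℕ}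
    (hc : c ∈ s) {j : ℕ} (hj : (τ c).1 = j) : theBox s τ j = c := by
  subst hj
  have hm := h.theBox_spec (h.fst_mem hc).1 (h.fst_mem hc).2
  exact h.injOn_fst hm.1 hc hm.2

/-- Labels of a periodic standard tableau increase for the componentwise order on boxes. -/
lemma IsPSYT.labelLT_of_le {μ : YoungDiagram} {τ : ℕ × ℕ → ℕ × ℕ} (h : IsPSYT μ.cells τ)
    {c d : ℕ × ℕ} (hd : d ∈ μ.cells) (hcd : c ≤ d) : c = d ∨ labelLT (τ c) (τ d) := by
  obtain ⟨i, j⟩ := c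
  obtain ⟨k, l⟩ := d
  obtain ⟨hik, hjl⟩ : i ≤ k ∧ j ≤ l := hcd
  have mem : ∀ {i' j'}, i' ≤ k → j' ≤ l → (i', j') ∈ μ.cells := fun hi hj =>
    μ.isLowerSet (show _ ≤ (k, l) from ⟨hi, hj⟩) hd
  have hrow : ∀ m, j + m ≤ l → (i, j) = (i, j + m) ∨ labelLT (τ (i, j)) (τ (i, j + m)) := by
    intro m
    induction m with
    | zero => intro _; exact .inl rfl
    | succ m ih =>
      intro hm
      have step := h.2.1 (i, j + m) (mem hik (by omega)) (i, j + m + 1) (mem hik (by omega)) rfl rfl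
      rcases ih (by omega) with e | e
      · exact .inr (e ▸ step)
      · exact .inr (labelLT_trans e step)
  have hcol : ∀ m, i + m ≤ k → (i, j) = (i + m, l) ∨ labelLT (τ (i, j)) (τ (i + m, l)) := by
    intro m
    induction m with
    | zero =>
      intro _
      have := hrow (l - j) (by omega)
      rwa [show j + (l - j) = l by omega] at this
    | succ m ih =>
      intro hm
      have step := h.2.2.1 (i + m, l) (mem (by omega) le_rfl) (i + m + 1, l)
        (mem (by omega) le_rfl) rfl rfl
      rcases ih (by omega) with e | e
      · exact .inr (e ▸ step)
      · exact .inr (labelLT_trans e step)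
  have := hcol (k - i) (by omega)
  rwa [show i + (k - i) = k by omega] at this

lemma swapNum_fst (τ : ℕ × ℕ → ℕ × ℕ) (i : ℕ) (c : ℕ × ℕ) :
    (swapNum τ i c).1 = Equiv.swap i (i + 1) (τ c).1 := by
  unfold swapNum
  rw [Equiv.swap_apply_def]
  split_ifs <;> rfl

lemma swapNum_snd (τ : ℕ × ℕ → ℕ × ℕ) (i : ℕ) (c : ℕ × ℕ) : (swapNum τ i c).2 = (τ c).2 := by
  unfold swapNum
  split_ifs <;> rfl

lemma swapNum_swapNum (τ : ℕ × ℕ → ℕ × ℕ) (i : ℕ) : swapNum (swapNum τ i) i = τ := by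
  funext c
  ext
  · rw [swapNum_fst, swapNum_fst, Equiv.swap_apply_self]
  · rw [swapNum_snd, swapNum_snd]

lemma InFiber.swapNum {s : Finset (ℕ × ℕ)} {T : ℕ × ℕ → ℕ} {τ : ℕ × ℕ → ℕ × ℕ}
    (h : InFiber s T τ) {i : ℕ} {a b : ℕ × ℕ} (ha : a ∈ s) (hb : b ∈ s) (hai : (τ a).1 = i)
    (hbi : (τ b).1 = i + 1) (hab : T a = T b → ¬ a ≤ b) : InFiber s T (swapNum τ i) := by
  have hi := h.1.fst_mem ha
  have hi' := h.1.fst_mem hb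
  have key : ∀ c ∈ s, ∀ d ∈ s, c ≤ d → labelLT (τ c) (τ d) →
      labelLT (_root_.swapNum τ i c) (_root_.swapNum τ i d) := by
    intro c hc d hd hcd hlt
    unfold labelLT at *
    simp only [swapNum_snd, swapNum_fst]
    refine hlt.imp_right fun ⟨hw, hlt⟩ => ⟨hw, ?_⟩
    have hne : ¬ ((τ c).1 = i ∧ (τ d).1 = i + 1) := by
      rintro ⟨hci, hdi⟩
      obtain rfl := h.1.injOn_fst hc ha (hci.trans hai.symm)
      obtain rfl := h.1.injOn_fst hd hb (hdi.trans hbi.symm)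
      rw [h.2 _ hc, h.2 _ hd] at hw
      exact hab hw hcd
    simp only [Equiv.swap_apply_def]
    split_ifs <;> omega
  refine ⟨⟨?_, ?_, ?_, ?_⟩, ?_⟩
  · intro j h1 hn
    have hj : 1 ≤ Equiv.swap i (i + 1) j ∧ Equiv.swap i (i + 1) j ≤ s.card := by
      rw [Equiv.swap_apply_def]
      split_ifs <;> omega
    have := h.1.1 _ hj.1 hj.2
    simpa only [swapNum_fst, Equiv.swap_apply_eq_iff] using this
  · intro c hc d hd h1 h2
    exact key c hc d hd ⟨h1.le, by omega⟩ (h.1.2.1 c hc d hd h1 h2)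
  · intro c hc d hd h1 h2
    exact key c hc d hd ⟨by omega, h2.le⟩ (h.1.2.2.1 c hc d hd h1 h2)
  · intro c hc
    have := h.1.2.2.2 c hc
    ext
    · rw [swapNum_fst, this, Equiv.swap_apply_of_ne_of_ne (by simp; omega) (by simp)]
    · rw [swapNum_snd, this]
  · intro c hc
    rw [swapNum_snd, h.2 c hc]

lemma IsPSYT.sum_swapNum {s : Finset (ℕ × ℕ)} {τ : ℕ × ℕ → ℕ × ℕ} (h : IsPSYT s τ) {i : ℕ}
    {a b : ℕ × ℕ} (ha : a ∈ s) (hb : b ∈ s) (hai : (τ a).1 = i) (hbi : (τ b).1 = i + 1)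
    (f : ℕ × ℕ → ℤ) :
    ∑ c ∈ s, ((swapNum τ i c).1 : ℤ) * f c = ∑ c ∈ s, ((τ c).1 : ℤ) * f c + f a - f b := by
  have hpt : ∀ c ∈ s, ((swapNum τ i c).1 : ℤ) * f c =
      ((τ c).1 : ℤ) * f c + (if c = a then f c else 0) - (if c = b then f c else 0) := by
    intro c hc
    have hca : c = a ↔ (τ c).1 = i :=
      ⟨fun e => e ▸ hai, fun e => h.injOn_fst hc ha (e.trans hai.symm)⟩
    have hcb : c = b ↔ (τ c).1 = i + 1 :=
      ⟨fun e => e ▸ hbi, fun e => h.injOn_fst hc hb (e.trans hbi.symm)⟩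
    rw [swapNum_fst, Equiv.swap_apply_def]
    simp only [hca, hcb]
    split_ifs with h1 h2 h2
    · omega
    · rw [h1]; push_cast; ring
    · rw [h2]; push_cast; ring
    · ring
  rw [Finset.sum_congr rfl hpt, Finset.sum_sub_distrib, Finset.sum_add_distrib,
    Finset.sum_ite_eq' s a, Finset.sum_ite_eq' s b, if_pos ha, if_pos hb]

/-- A statistic which strictly increases along the cover relations of `PSYT(λ)`. -/
def psytStat (s : Finset (ℕ × ℕ)) (τ : ℕ × ℕ → ℕ × ℕ) : ℤ ×ₗ ℤ ×ₗ ℤ :=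
  toLex (∑ c ∈ s, ((τ c).2 : ℤ), toLex (∑ c ∈ s, ((τ c).1 : ℤ) * -((τ c).2 : ℤ),
    ∑ c ∈ s, ((τ c).1 : ℤ) * content c))

lemma psytCover.eq_or_psytStat_lt {s : Finset (ℕ × ℕ)} {τ σ : ℕ × ℕ → ℕ × ℕ}
    (h : psytCover s τ σ) : τ = σ ∨ psytStat s τ < psytStat s σ := by
  obtain ⟨hτ, hσ, rfl | ⟨i, h1, hn, rfl, hw⟩⟩ := h
  · rcases s.eq_empty_or_nonempty with rfl | hs
    · left
      funext c
      rw [hτ.2.2.2 c (by simp), hσ.2.2.2 c (by simp)]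
    · right
      obtain ⟨c, ⟨hc, hc1⟩, -⟩ := hτ.1 1 le_rfl hs.card_pos
      simp only [psytStat, Prod.Lex.toLex_lt_toLex]
      left
      apply Finset.sum_lt_sum
      · intro d hd
        simp only [psiTab, hd, if_true]
        split_ifs <;> simp
      · exact ⟨c, hc, by simp [psiTab, hc, hc1]⟩
  · right
    have ha := hτ.theBox_spec h1 (by omega)
    have hb := hτ.theBox_spec (j := i + 1) (by omega) hn
    simp only [psytStat, Prod.Lex.toLex_lt_toLex, swapNum_snd,
      hτ.sum_swapNum ha.1 hb.1 ha.2 hb.2]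
    refine .inr ⟨trivial, ?_⟩
    rcases hw with hw | ⟨hw, hc⟩
    · unfold wOf at hw
      exact .inl (by omega)
    · unfold wOf at hw
      unfold cOf at hc
      exact .inr ⟨by omega, by omega⟩

lemma psytLE.eq_or_psytStat_lt {s : Finset (ℕ × ℕ)} {τ σ : ℕ × ℕ → ℕ × ℕ}
    (h : psytLE s τ σ) : τ = σ ∨ psytStat s τ < psytStat s σ := by
  induction h with
  | refl => exact .inl rfl
  | tail _ hc ih =>
    rcases hc.eq_or_psytStat_lt with rfl | h
    · exact ih
    · rcases ih with rfl | h'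
      · exact .inr h
      · exact .inr (h'.trans h)

lemma psytLE_antisymm {s : Finset (ℕ × ℕ)} {τ σ : ℕ × ℕ → ℕ × ℕ}
    (h : psytLE s τ σ) (h' : psytLE s σ τ) : τ = σ := by
  rcases h.eq_or_psytStat_lt with h | h
  · exact h
  · rcases h'.eq_or_psytStat_lt with h' | h'
    · exact h'.symm
    · exact absurd (h.trans h') (lt_irrefl _)

/-- A total order on boxes for which, among boxes of equal `T`-value, smaller boxes in the
componentwise order come first. -/
structure IsReading (T : ℕ × ℕ → ℕ) (R : ℕ × ℕ → ℕ × ℕ → Prop) : Prop where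
  irrefl : ∀ c, ¬ R c c
  trans : ∀ c d e, R c d → R d e → R c e
  total : ∀ c d, c ≠ d → R c d ∨ R d c
  of_le : ∀ c d, c ≤ d → c ≠ d → T c = T d → R c d

lemma isReading_minOrd (T : ℕ × ℕ → ℕ) : IsReading T (minOrd T) where
  irrefl c := by unfold minOrd rowReadLT; omega
  trans c d e := by unfold minOrd rowReadLT; omega
  total c d h := by rw [Ne, Prod.ext_iff] at h; unfold minOrd rowReadLT; omega
  of_le c d h hne := by
    rw [Ne, Prod.ext_iff] at hne; rw [Prod.le_def] at h; unfold minOrd rowReadLT; omega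

lemma isReading_boxLT (T : ℕ × ℕ → ℕ) : IsReading T (boxLT T) where
  irrefl c := by unfold boxLT colReadLT; omega
  trans c d e := by unfold boxLT colReadLT; omega
  total c d h := by rw [Ne, Prod.ext_iff] at h; unfold boxLT colReadLT; omega
  of_le c d h hne := by
    rw [Ne, Prod.ext_iff] at hne; rw [Prod.le_def] at h; unfold boxLT colReadLT; omega

/-- The position of `c` when the boxes of `s` are listed along `R`. -/
noncomputable def readRank (s : Finset (ℕ × ℕ)) (R : ℕ × ℕ → ℕ × ℕ → Prop) (c : ℕ × ℕ) : ℕ :=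
  (s.filter fun d => R d c).card + 1

/-- The tableau numbering the boxes along `R`, with `q`-exponents `T`. -/
noncomputable def readTab (s : Finset (ℕ × ℕ)) (T : ℕ × ℕ → ℕ) (R : ℕ × ℕ → ℕ × ℕ → Prop) :
    ℕ × ℕ → ℕ × ℕ :=
  fun c => if c ∈ s then (readRank s R c, T c) else (0, 0)

section Reading

variable {s : Finset (ℕ × ℕ)} {T : ℕ × ℕ → ℕ} {R : ℕ × ℕ → ℕ × ℕ → Prop}

lemma IsReading.readRank_lt (hR : IsReading T R) {c d : ℕ × ℕ} (hc : c ∈ s) (h : R c d) :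
    readRank s R c < readRank s R d := by
  refine Nat.succ_lt_succ (Finset.card_lt_card (Finset.ssubset_iff_of_subset ?_ |>.2 ⟨c, ?_, ?_⟩))
  · intro e he
    rw [Finset.mem_filter] at he ⊢
    exact ⟨he.1, hR.trans _ _ _ he.2 h⟩
  · exact Finset.mem_filter.2 ⟨hc, h⟩
  · exact fun hm => hR.irrefl c (Finset.mem_filter.1 hm).2

lemma IsReading.readRank_le_card (hR : IsReading T R) {c : ℕ × ℕ} (hc : c ∈ s) :
    readRank s R c ≤ s.card := by
  refine Nat.succ_le_of_lt (Finset.card_lt_card (Finset.ssubset_iff_of_subset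
    (Finset.filter_subset _ _) |>.2 ⟨c, hc, ?_⟩))
  exact fun hm => hR.irrefl c (Finset.mem_filter.1 hm).2

lemma IsReading.readRank_injOn (hR : IsReading T R) : Set.InjOn (readRank s R) s := by
  intro c hc d hd h
  by_contra hne
  rcases hR.total c d hne with h' | h'
  · exact (hR.readRank_lt hc h').ne h
  · exact (hR.readRank_lt hd h').ne' h

lemma IsReading.image_readRank (hR : IsReading T R) :
    s.image (readRank s R) = Finset.Icc 1 s.card := by
  apply Finset.eq_of_subset_of_card_le
  · intro j hj
    obtain ⟨c, hc, rfl⟩ := Finset.mem_image.1 hj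
    exact Finset.mem_Icc.2 ⟨Nat.succ_pos _, hR.readRank_le_card hc⟩
  · rw [Finset.card_image_of_injOn hR.readRank_injOn]
    simp

lemma IsReading.inFiber_readTab (hR : IsReading T R) (hT : IsRYT s T) :
    InFiber s T (readTab s T R) := by
  have key : ∀ c ∈ s, ∀ d ∈ s, c ≤ d → c ≠ d → T d ≤ T c →
      labelLT (readTab s T R c) (readTab s T R d) := by
    intro c hc d hd hcd hne hle
    simp only [readTab, hc, hd, if_true, labelLT]
    rcases hle.lt_or_eq with h | h
    · exact .inl h
    · exact .inr ⟨h.symm, hR.readRank_lt hc (hR.of_le c d hcd hne h.symm)⟩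
  refine ⟨⟨?_, ?_, ?_, ?_⟩, ?_⟩
  · intro j h1 hn
    have hj : j ∈ s.image (readRank s R) := by
      rw [hR.image_readRank]; exact Finset.mem_Icc.2 ⟨h1, hn⟩
    obtain ⟨c, hc, hcj⟩ := Finset.mem_image.1 hj
    refine ⟨c, ⟨hc, by simp [readTab, hc, hcj]⟩, ?_⟩
    rintro d ⟨hd, hdj⟩
    simp only [readTab, hd, if_true] at hdj
    exact hR.readRank_injOn hd hc (hdj.trans hcj.symm)
  · intro c hc d hd h1 h2
    exact key c hc d hd ⟨h1.le, by omega⟩ (by rintro rfl; omega) (hT.1 c hc d hd h1 h2)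
  · intro c hc d hd h1 h2
    exact key c hc d hd ⟨by omega, h2.le⟩ (by rintro rfl; omega) (hT.2.1 c hc d hd h1 h2)
  · intro c hc
    simp [readTab, hc]
  · intro c hc
    simp [readTab, hc]

/-- A tableau of the fiber whose consecutive numbers are in reading order is the reading
tableau. -/
lemma IsReading.eq_readTab (hR : IsReading T R) {τ : ℕ × ℕ → ℕ × ℕ} (h : InFiber s T τ)
    (hs : ∀ a ∈ s, ∀ b ∈ s, (τ b).1 = (τ a).1 + 1 → R a b) : τ = readTab s T R := by
  have mono : ∀ k, ∀ a ∈ s, ∀ b ∈ s, (τ b).1 = (τ a).1 + k + 1 → R a b := by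
    intro k
    induction k with
    | zero => exact hs
    | succ k ih =>
      intro a ha b hb hab
      have h1 := h.1.fst_mem ha
      have h2 := h.1.fst_mem hb
      obtain ⟨c, ⟨hc, hcj⟩, -⟩ := h.1.1 ((τ a).1 + k + 1) (by omega) (by omega)
      exact hR.trans _ _ _ (ih a ha c hc hcj) (hs c hc b hb (by omega))
  have hiff : ∀ a ∈ s, ∀ b ∈ s, R a b ↔ (τ a).1 < (τ b).1 := by
    intro a ha b hb
    have hlt : ∀ a ∈ s, ∀ b ∈ s, (τ a).1 < (τ b).1 → R a b := fun a ha b hb hlt =>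
      mono ((τ b).1 - (τ a).1 - 1) a ha b hb (by omega)
    refine ⟨fun hab => ?_, hlt a ha b hb⟩
    by_contra hle
    rcases (not_lt.1 hle).lt_or_eq with h' | h'
    · exact hR.irrefl _ (hR.trans _ _ _ hab (hlt b hb a ha h'))
    · obtain rfl := h.1.injOn_fst hb ha h'
      exact hR.irrefl _ hab
  funext c
  by_cases hc : c ∈ s
  · simp only [readTab, hc, if_true]
    refine Prod.ext ?_ (h.2 c hc)
    have himg : (s.filter fun d => R d c).image (fun d => (τ d).1) = Finset.Ico 1 (τ c).1 := by
      ext j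
      simp only [Finset.mem_image, Finset.mem_filter, Finset.mem_Ico]
      constructor
      · rintro ⟨d, ⟨hd, hdc⟩, rfl⟩
        exact ⟨(h.1.fst_mem hd).1, (hiff d hd c hc).1 hdc⟩
      · rintro ⟨h1, h2⟩
        obtain ⟨d, ⟨hd, hdj⟩, -⟩ := h.1.1 j h1 (h2.le.trans (h.1.fst_mem hc).2)
        exact ⟨d, ⟨hd, (hiff d hd c hc).2 (hdj ▸ h2)⟩, hdj⟩
    have hcard := congrArg Finset.card himg
    rw [Finset.card_image_of_injOn
      (h.1.injOn_fst.mono (Finset.coe_subset.2 (Finset.filter_subset _ _))), Nat.card_Ico] at hcard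
    have := (h.1.fst_mem hc).1
    unfold readRank
    omega
  · rw [h.1.2.2.2 c hc]
    simp [readTab, hc]

/-- Bubble sort on a fiber: every tableau is reached from the reading tableau by exchanging
consecutive numbers that are out of reading order. -/
lemma IsReading.induction (hR : IsReading T R) {P : (ℕ × ℕ → ℕ × ℕ) → Prop}
    (base : P (readTab s T R))
    (step : ∀ τ, InFiber s T τ → ∀ a ∈ s, ∀ b ∈ s, (τ b).1 = (τ a).1 + 1 → R b a →
      InFiber s T (swapNum τ (τ a).1) → P (swapNum τ (τ a).1) → P τ)
    (τ : ℕ × ℕ → ℕ × ℕ) (hτ : InFiber s T τ) : P τ := by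
  have bound : ∀ τ, InFiber s T τ →
      ∑ c ∈ s, ((τ c).1 : ℤ) * (readRank s R c : ℤ) ≤ ∑ _c ∈ s, (s.card : ℤ) * (s.card : ℤ) := by
    intro τ hτ
    refine Finset.sum_le_sum fun c hc => ?_
    have h1 := (hτ.1.fst_mem hc).2
    have h2 := hR.readRank_le_card hc
    gcongr
  induction hk : (∑ _c ∈ s, (s.card : ℤ) * (s.card : ℤ)
      - ∑ c ∈ s, ((τ c).1 : ℤ) * (readRank s R c : ℤ)).toNat
    using Nat.strong_induction_on generalizing τ with
  | _ k ih =>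
    by_cases hs : ∀ a ∈ s, ∀ b ∈ s, (τ b).1 = (τ a).1 + 1 → R a b
    · rw [hR.eq_readTab hτ hs]
      exact base
    · push Not at hs
      obtain ⟨a, ha, b, hb, hab, hnR⟩ := hs
      have hba : R b a := (hR.total a b (by rintro rfl; omega)).resolve_left hnR
      have hσ : InFiber s T (swapNum τ (τ a).1) := hτ.swapNum ha hb rfl hab fun hTab hle =>
        hnR (hR.of_le a b hle (by rintro rfl; omega) hTab)
      refine step τ hτ a ha b hb hab hba hσ (ih _ ?_ _ hσ rfl)
      have h1 := hτ.1.sum_swapNum ha hb rfl hab fun c => (readRank s R c : ℤ)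
      have h2 := hR.readRank_lt hb hba
      have h3 := bound _ hσ
      have h4 := bound _ hτ
      omega

end Reading

/-- Exchanging `i` and `i + 1` goes up when `i` lies in a box of smaller `T`-value, or of equal
`T`-value and content larger by at least two. -/
lemma InFiber.psytCover_swapNum {s : Finset (ℕ × ℕ)} {T : ℕ × ℕ → ℕ} {τ : ℕ × ℕ → ℕ × ℕ}
    (h : InFiber s T τ) {i : ℕ} (h' : InFiber s T (_root_.swapNum τ i)) {a b : ℕ × ℕ}
    (ha : a ∈ s) (hb : b ∈ s) (hai : (τ a).1 = i) (hbi : (τ b).1 = i + 1)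
    (hab : T a < T b ∨ (T a = T b ∧ 1 < content a - content b)) :
    psytCover s τ (_root_.swapNum τ i) := by
  refine ⟨h.1, h'.1, .inr ⟨i, hai ▸ (h.1.fst_mem ha).1, hbi ▸ (h.1.fst_mem hb).2, rfl, ?_⟩⟩
  simpa only [wOf, cOf, h.1.theBox_eq ha hai, h.1.theBox_eq hb hbi, h.2 a ha, h.2 b hb] using hab

lemma InFiber.not_le {μ : YoungDiagram} {T : ℕ × ℕ → ℕ} {τ : ℕ × ℕ → ℕ × ℕ}
    (h : InFiber μ.cells T τ) {a b : ℕ × ℕ} (ha : a ∈ μ.cells) (hb : b ∈ μ.cells)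
    (hab : (τ a).1 < (τ b).1) (hT : T a = T b) : ¬ (b.1 ≤ a.1 ∧ b.2 ≤ a.2) := by
  intro hle
  rcases h.1.labelLT_of_le ha (show b ≤ a from hle) with rfl | hlt
  · exact hab.false
  · unfold labelLT at hlt
    rw [h.2 a ha, h.2 b hb] at hlt
    omega

lemma readTab_minOrd_le {μ : YoungDiagram} {T : ℕ × ℕ → ℕ} (τ : ℕ × ℕ → ℕ × ℕ)
    (hτ : InFiber μ.cells T τ) : psytLE μ.cells (readTab μ.cells T (minOrd T)) τ := by
  refine (isReading_minOrd T).induction (P := psytLE μ.cells _) .refl ?_ τ hτ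
  intro τ hτ a ha b hb hab hba hσ ih
  refine ih.tail ?_
  have hcov := hσ.psytCover_swapNum (i := (τ a).1) (by rwa [swapNum_swapNum]) hb ha
    (by rw [swapNum_fst, hab, Equiv.swap_apply_right])
    (by rw [swapNum_fst, Equiv.swap_apply_left]) ?_
  · rwa [swapNum_swapNum] at hcov
  · have := hτ.not_le ha hb (by omega)
    unfold minOrd rowReadLT at hba
    unfold content
    omega

lemma le_readTab_boxLT {μ : YoungDiagram} {T : ℕ × ℕ → ℕ} (τ : ℕ × ℕ → ℕ × ℕ)
    (hτ : InFiber μ.cells T τ) : psytLE μ.cells τ (readTab μ.cells T (boxLT T)) := by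
  refine (isReading_boxLT T).induction (P := fun τ => psytLE μ.cells τ _) .refl ?_ τ hτ
  intro τ hτ a ha b hb hab hba hσ ih
  refine .head (hτ.psytCover_swapNum hσ ha hb rfl hab ?_) ih
  have := hτ.not_le ha hb (by omega)
  unfold boxLT colReadLT at hba
  unfold content
  omega

/-- Let `λ` be a partition of `n` and `T ∈ RYT(λ)`. Then the fiber
`PSYT(λ;T)` contains a unique element `Min(T)` below every element of the fiber, and a
unique element `Top(T)` above every element of the fiber, for the partial order `≤` on
`PSYT(λ)`. -/
theorem statement0 (μ : YoungDiagram) (n : ℕ) (hn : μ.card = n)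
    (T : ℕ × ℕ → ℕ) (hT : IsRYT μ.cells T) :
    (∃! m : ℕ × ℕ → ℕ × ℕ, InFiber μ.cells T m ∧
      ∀ τ, InFiber μ.cells T τ → psytLE μ.cells m τ) ∧
    (∃! M : ℕ × ℕ → ℕ × ℕ, InFiber μ.cells T M ∧
      ∀ τ, InFiber μ.cells T τ → psytLE μ.cells τ M) := by
  have hm := (isReading_minOrd T).inFiber_readTab hT
  have hM := (isReading_boxLT T).inFiber_readTab hT
  exact ⟨⟨_, ⟨hm, readTab_minOrd_le⟩, fun m' hm' =>
      psytLE_antisymm (hm'.2 _ hm) (readTab_minOrd_le _ hm'.1)⟩,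
    ⟨_, ⟨hM, le_readTab_boxLT⟩, fun M' hM' =>
      psytLE_antisymm (le_readTab_boxLT _ hM'.1) (hM'.2 _ hM)⟩⟩
end

section
/- Let λ be a partition of n. The operators T_1,…,T_{n−1} on V_λ satisfy the finite Hecke algebra relations: (T_i − 1)(T_i + t) = 0 for 1 ≤ i ≤ n−1; T_iT_{i+1}T_i = T_{i+1}T_iT_{i+1} for 1 ≤ i ≤ n−2; and T_iT_j = T_jT_i for |i−j| > 1. Moreover each T_i is invertible and, defining θ̄_1 := 1 and θ̄_{i+1} := tT_i^{−1}θ̄_iT_i^{−1}, one has θ̄_i e_τ = t^{c_τ(i)} e_τ for all τ ∈ SYT(λ) and 1 ≤ i ≤ n. Finally, the only subspaces of V_λ invariant under all of T_1,…,T_{n−1} are 0 and V_λ. -/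
open scoped Classical

/-- `τ` is a standard Young tableau on the finite cell set `s`: a bijective labelling of
the boxes by `1, …, s.card`, strictly increasing along rows and columns (normalized to
`0` off `s`). -/
def IsSYT (s : Finset (ℕ × ℕ)) (τ : ℕ × ℕ → ℕ) : Prop :=
  (∀ j, 1 ≤ j → j ≤ s.card → ∃! c, c ∈ s ∧ τ c = j) ∧
  (∀ c ∈ s, ∀ c' ∈ s, c.1 = c'.1 → c.2 + 1 = c'.2 → τ c < τ c') ∧
  (∀ c ∈ s, ∀ c' ∈ s, c.1 + 1 = c'.1 → c.2 = c'.2 → τ c < τ c') ∧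
  (∀ c, c ∉ s → τ c = 0)

/-- The type of standard Young tableaux on `s`. -/
abbrev SYTt (s : Finset (ℕ × ℕ)) : Type := {τ : ℕ × ℕ → ℕ // IsSYT s τ}

/-- The (unique) box of `s` labelled `j` by the tableau `τ`. -/
noncomputable def theBoxS (s : Finset (ℕ × ℕ)) (τ : ℕ × ℕ → ℕ) (j : ℕ) : ℕ × ℕ :=
  if h : ∃ c, c ∈ s ∧ τ c = j then h.choose else (0, 0)

/-- The labelling obtained from `τ` by exchanging the labels `i` and `i + 1`. -/
def swapS (τ : ℕ × ℕ → ℕ) (i : ℕ) : ℕ × ℕ → ℕ :=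
  fun c => if τ c = i then i + 1 else if τ c = i + 1 then i else τ c

/-- The field `ℚ(t)`. -/
abbrev Qt : Type := RatFunc ℚ

/-- The variable `t ∈ ℚ(t)`. -/
noncomputable def tV : Qt := RatFunc.X

/-- The `ℚ(t)`-vector space `V_λ` with basis `{e_τ : τ ∈ SYT(λ)}`. -/
abbrev Vsp (s : Finset (ℕ × ℕ)) : Type := SYTt s →₀ Qt

/-- The image of the basis vector `e_τ` under the seminormal operator `T_i`:
`T_i e_τ = e_τ` if `i, i+1` are in the same row of `τ`; `T_i e_τ = −t e_τ` if they are in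
the same column; `T_i e_τ = e_{s_i(τ)} + ((1−t)t^{c_τ(i)}/(t^{c_τ(i)} − t^{c_τ(i+1)})) e_τ`
if `s_i(τ) > τ` (i.e. `c_τ(i) − c_τ(i+1) > 1`); and
`T_i e_τ = −((t^{c_τ(i+1)+1} − t^{c_τ(i)})(t^{c_τ(i)+1} − t^{c_τ(i+1)})/(t^{c_τ(i+1)} −
t^{c_τ(i)})²) e_{s_i(τ)} + ((1−t)t^{c_τ(i)}/(t^{c_τ(i)} − t^{c_τ(i+1)})) e_τ` if
`s_i(τ) < τ`. -/
noncomputable def Tact (s : Finset (ℕ × ℕ)) (i : ℕ) (τ : SYTt s) : Vsp s :=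
  let b1 := theBoxS s τ.1 i
  let b2 := theBoxS s τ.1 (i + 1)
  let c1 := content b1
  let c2 := content b2
  if b1.1 = b2.1 then Finsupp.single τ 1
  else if b1.2 = b2.2 then Finsupp.single τ (-tV)
  else if h : IsSYT s (swapS τ.1 i) then
    (if 1 < c1 - c2 then
      Finsupp.single (⟨swapS τ.1 i, h⟩ : SYTt s) 1 +
        Finsupp.single τ ((1 - tV) * tV ^ c1 / (tV ^ c1 - tV ^ c2))
    else
      Finsupp.single (⟨swapS τ.1 i, h⟩ : SYTt s)
          (-((tV ^ (c2 + 1) - tV ^ c1) * (tV ^ (c1 + 1) - tV ^ c2) /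
            (tV ^ c2 - tV ^ c1) ^ 2)) +
        Finsupp.single τ ((1 - tV) * tV ^ c1 / (tV ^ c1 - tV ^ c2)))
  else 0

/-- The seminormal operator `T_i` on `V_λ`, as a linear endomorphism. -/
noncomputable def heckeT (s : Finset (ℕ × ℕ)) (i : ℕ) : Module.End Qt (Vsp s) :=
  Finsupp.lift (Vsp s) Qt (SYTt s) (Tact s i)

/-- The Jucys–Murphy elements `θ̄_1 := 1`, `θ̄_{i+1} := t T_i⁻¹ θ̄_i T_i⁻¹`, built from a
family `S` of inverses of the `T_i` (here `thetaBar S k` represents `θ̄_{k+1}`). -/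
noncomputable def thetaBar {s : Finset (ℕ × ℕ)} (S : ℕ → Module.End Qt (Vsp s)) :
    ℕ → Module.End Qt (Vsp s)
  | 0 => 1
  | k + 1 => tV • (S (k + 1) * thetaBar S k * S (k + 1))

/-! ### Labellings of a finite set of cells -/

/-- `f` labels the cells of `s` bijectively by `1, …, s.card` and vanishes off `s`. -/
def IsLabelling (s : Finset (ℕ × ℕ)) (f : ℕ × ℕ → ℕ) : Prop :=
  Set.BijOn f s (Set.Icc 1 s.card) ∧ ∀ c, c ∉ s → f c = 0

theorem IsLabelling.existsUnique {s : Finset (ℕ × ℕ)} {f : ℕ × ℕ → ℕ} (hf : IsLabelling s f)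
    {j : ℕ} (h1 : 1 ≤ j) (h2 : j ≤ s.card) : ∃! c, c ∈ s ∧ f c = j := by
  obtain ⟨c, hc, rfl⟩ := hf.1.surjOn ⟨h1, h2⟩
  exact ⟨c, ⟨hc, rfl⟩, fun d hd => hf.1.injOn hd.1 hc hd.2⟩

theorem IsSYT.isLabelling {s : Finset (ℕ × ℕ)} {f : ℕ × ℕ → ℕ} (hf : IsSYT s f) :
    IsLabelling s f := by
  have hsub : Finset.Icc 1 s.card ⊆ s.image f := by
    intro j hj
    obtain ⟨h1, h2⟩ := Finset.mem_Icc.1 hj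
    obtain ⟨c, hc, -⟩ := hf.1 j h1 h2
    exact Finset.mem_image.2 ⟨c, hc⟩
  have heq : Finset.Icc 1 s.card = s.image f :=
    Finset.eq_of_subset_of_card_le hsub (by simpa using Finset.card_image_le)
  have hinj : Set.InjOn f s := by
    rw [← Finset.card_image_iff, ← heq]
    simp
  refine ⟨⟨fun c hc => ?_, hinj, fun j hj => ?_⟩, hf.2.2.2⟩
  · have : f c ∈ s.image f := Finset.mem_image_of_mem f hc
    rw [← heq] at this
    exact Finset.mem_Icc.1 this
  · have : j ∈ s.image f := hsub (Finset.mem_Icc.2 hj)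
    simpa using this

theorem IsLabelling.eq_of_label_eq {s : Finset (ℕ × ℕ)} {f : ℕ × ℕ → ℕ} (hf : IsLabelling s f)
    {p q : ℕ × ℕ} (hp : p ∈ s) (hq : q ∈ s) (h : f p = f q) : p = q :=
  hf.1.injOn hp hq h

theorem IsLabelling.theBoxS_eq {s : Finset (ℕ × ℕ)} {f : ℕ × ℕ → ℕ} (hf : IsLabelling s f)
    {p : ℕ × ℕ} {i : ℕ} (hp : p ∈ s) (hpi : f p = i) : theBoxS s f i = p := by
  have h : ∃ c, c ∈ s ∧ f c = i := ⟨p, hp, hpi⟩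
  rw [theBoxS, dif_pos h]
  exact hf.eq_of_label_eq h.choose_spec.1 hp (h.choose_spec.2.trans hpi.symm)

theorem swapS_apply (f : ℕ × ℕ → ℕ) (i : ℕ) (c : ℕ × ℕ) :
    swapS f i c = Equiv.swap i (i + 1) (f c) := by
  rw [swapS, Equiv.swap_apply_def]

theorem swapS_eq_comp (f : ℕ × ℕ → ℕ) (i : ℕ) : swapS f i = Equiv.swap i (i + 1) ∘ f :=
  funext (swapS_apply f i)

theorem swapS_swapS (f : ℕ × ℕ → ℕ) (i : ℕ) : swapS (swapS f i) i = f := by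
  funext c
  simp [swapS_apply]

theorem swapS_braid (f : ℕ × ℕ → ℕ) (i : ℕ) :
    swapS (swapS (swapS f i) (i + 1)) i = swapS (swapS (swapS f (i + 1)) i) (i + 1) := by
  funext c
  simp only [swapS]
  grind

theorem swapS_comm (f : ℕ × ℕ → ℕ) {i j : ℕ} (h : i + 1 < j ∨ j + 1 < i) :
    swapS (swapS f i) j = swapS (swapS f j) i := by
  funext c
  simp only [swapS]
  grind

theorem swapS_of_eq {f : ℕ × ℕ → ℕ} {i : ℕ} {p : ℕ × ℕ} (h : f p = i) :
    swapS f i p = i + 1 := by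
  simp [swapS, h]

theorem swapS_of_eq_succ {f : ℕ × ℕ → ℕ} {i : ℕ} {p : ℕ × ℕ} (h : f p = i + 1) :
    swapS f i p = i := by
  simp [swapS, h]

theorem swapS_of_ne {f : ℕ × ℕ → ℕ} {i j : ℕ} {p : ℕ × ℕ} (h : f p = j) (h1 : j ≠ i)
    (h2 : j ≠ i + 1) : swapS f i p = j := by
  simp [swapS, h, h1, h2]

theorem IsLabelling.swapS {s : Finset (ℕ × ℕ)} {f : ℕ × ℕ → ℕ} (hf : IsLabelling s f)
    {i : ℕ} (h1 : 1 ≤ i) (h2 : i + 1 ≤ s.card) : IsLabelling s (swapS f i) := by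
  refine ⟨?_, fun c hc => ?_⟩
  · rw [swapS_eq_comp]
    refine Set.BijOn.comp ?_ hf.1
    refine Equiv.bijOn' _ (fun j hj => ?_) (fun j hj => ?_) <;>
    · simp only [Equiv.symm_swap, Equiv.swap_apply_def, Set.mem_Icc] at hj ⊢
      grind
  · exact swapS_of_ne (hf.2 c hc) (by omega) (by omega)

theorem IsLabelling.isSYT {s : Finset (ℕ × ℕ)} {f : ℕ × ℕ → ℕ} (hf : IsLabelling s f)
    (hrow : ∀ c ∈ s, ∀ c' ∈ s, c.1 = c'.1 → c.2 + 1 = c'.2 → f c < f c')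
    (hcol : ∀ c ∈ s, ∀ c' ∈ s, c.1 + 1 = c'.1 → c.2 = c'.2 → f c < f c') : IsSYT s f :=
  ⟨fun _ h1 h2 => hf.existsUnique h1 h2, hrow, hcol, hf.2⟩

theorem IsSYT.swapS {s : Finset (ℕ × ℕ)} {f : ℕ × ℕ → ℕ} (hf : IsSYT s f) {i : ℕ}
    (h1 : 1 ≤ i) (h2 : i + 1 ≤ s.card) {p q : ℕ × ℕ} (hp : p ∈ s) (hq : q ∈ s)
    (hpi : f p = i) (hqi : f q = i + 1) (hr : p.1 ≠ q.1) (hc : p.2 ≠ q.2) :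
    IsSYT s (swapS f i) := by
  have hl := hf.isLabelling
  have key : ∀ c ∈ s, ∀ c' ∈ s, (c.1 = c'.1 ∨ c.2 = c'.2) → f c < f c' →
      _root_.swapS f i c < _root_.swapS f i c' := by
    intro c hcs c' hcs' hor hlt
    have hne : ¬ (f c = i ∧ f c' = i + 1) := by
      rintro ⟨e1, e2⟩
      have := hl.eq_of_label_eq hcs hp (e1.trans hpi.symm)
      have := hl.eq_of_label_eq hcs' hq (e2.trans hqi.symm)
      subst_vars
      tauto
    simp only [_root_.swapS]
    grind
  exact (hl.swapS h1 h2).isSYT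
    (fun c hcs c' hcs' e1 e2 => key c hcs c' hcs' (.inl e1) (hf.2.1 c hcs c' hcs' e1 e2))
    (fun c hcs c' hcs' e1 e2 => key c hcs c' hcs' (.inr e2) (hf.2.2.1 c hcs c' hcs' e1 e2))

/-! ### Standard tableaux on a Young diagram -/

theorem IsSYT.add_dist_le {μ : YoungDiagram} {f : ℕ × ℕ → ℕ} (hf : IsSYT μ.cells f)
    {i j : ℕ} (a b : ℕ) (h : (i + a, j + b) ∈ μ.cells) :
    f (i, j) + a + b ≤ f (i + a, j + b) := by
  induction a with
  | zero =>
    induction b with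
    | zero => simp
    | succ b ih =>
      have hm : (i + 0, j + b) ∈ μ.cells := μ.up_left_mem le_rfl (by omega) h
      have := hf.2.1 _ hm _ h rfl rfl
      have := ih hm
      omega
  | succ a ih =>
    have hm : (i + a, j + b) ∈ μ.cells := μ.up_left_mem (by omega) le_rfl h
    have := hf.2.2.1 _ hm _ h rfl rfl
    have := ih hm
    omega

theorem IsSYT.add_dist_le_of_le {μ : YoungDiagram} {f : ℕ × ℕ → ℕ} (hf : IsSYT μ.cells f)
    {p q : ℕ × ℕ} (hq : q ∈ μ.cells) (h1 : p.1 ≤ q.1) (h2 : p.2 ≤ q.2) :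
    f p + (q.1 - p.1) + (q.2 - p.2) ≤ f q := by
  obtain ⟨i, j⟩ := p
  obtain ⟨k, l⟩ := q
  obtain ⟨a, rfl⟩ := Nat.exists_eq_add_of_le h1
  obtain ⟨b, rfl⟩ := Nat.exists_eq_add_of_le h2
  simpa using hf.add_dist_le a b hq

/-- The possible relative positions of two boxes with consecutive labels. -/
theorem IsSYT.consecutive {μ : YoungDiagram} {f : ℕ × ℕ → ℕ} (hf : IsSYT μ.cells f)
    {p q : ℕ × ℕ} (hp : p ∈ μ.cells) (hq : q ∈ μ.cells) (h : f q = f p + 1) :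
    (p.1 = q.1 ∧ p.2 + 1 = q.2) ∨ (p.1 + 1 = q.1 ∧ p.2 = q.2) ∨
      (p.1 < q.1 ∧ q.2 < p.2) ∨ (q.1 < p.1 ∧ p.2 < q.2) := by
  have hpq := hf.add_dist_le_of_le (p := p) hq
  have hqp := hf.add_dist_le_of_le (p := q) hp
  have hne : ¬ (p.1 = q.1 ∧ p.2 = q.2) := by
    rintro ⟨h1, h2⟩
    rw [Prod.ext h1 h2] at h
    omega
  omega

theorem IsSYT.content_ne_of_succ {μ : YoungDiagram} {f : ℕ × ℕ → ℕ} (hf : IsSYT μ.cells f)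
    {p q : ℕ × ℕ} (hp : p ∈ μ.cells) (hq : q ∈ μ.cells) (h : f q = f p + 1) :
    content p ≠ content q := by
  have := hf.consecutive hp hq h
  unfold content
  omega

theorem IsSYT.content_ne_of_add_two {μ : YoungDiagram} {f : ℕ × ℕ → ℕ} (hf : IsSYT μ.cells f)
    {p q : ℕ × ℕ} (hp : p ∈ μ.cells) (hq : q ∈ μ.cells) (h : f q = f p + 2) :
    content p ≠ content q := by
  intro hc
  unfold content at hc
  have hpq := hf.add_dist_le_of_le (p := p) hq
  have hqp := hf.add_dist_le_of_le (p := q) hp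
  have hne : ¬ (p.1 = q.1 ∧ p.2 = q.2) := by
    rintro ⟨h1, h2⟩
    rw [Prod.ext h1 h2] at h
    omega
  have h1 : q.1 = p.1 + 1 := by omega
  have h2 : q.2 = p.2 + 1 := by omega
  have hr : (p.1, p.2 + 1) ∈ μ.cells := μ.up_left_mem (by omega) h2.ge hq
  have hd : (p.1 + 1, p.2) ∈ μ.cells := μ.up_left_mem h1.ge (by omega) hq
  have e1 := hf.2.1 p hp _ hr rfl rfl
  have e2 := hf.2.2.1 _ hr q hq h1.symm h2.symm
  have e3 := hf.2.2.1 p hp _ hd rfl rfl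
  have e4 := hf.2.1 _ hd q hq h1.symm h2.symm
  have := hf.isLabelling.eq_of_label_eq hr hd (by omega)
  simp at this

theorem IsSYT.box_one {μ : YoungDiagram} {f : ℕ × ℕ → ℕ} (hf : IsSYT μ.cells f)
    {p : ℕ × ℕ} (hp : p ∈ μ.cells) (h : f p = 1) : p = (0, 0) := by
  have h0 : ((0, 0) : ℕ × ℕ) ∈ μ.cells := μ.up_left_mem (Nat.zero_le _) (Nat.zero_le _) hp
  have h1 := hf.add_dist_le_of_le (p := (0, 0)) hp (Nat.zero_le _) (Nat.zero_le _)
  have h2 := (hf.isLabelling.1.mapsTo h0).1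
  simp only at h1
  exact Prod.ext (by simp only; omega) (by simp only; omega)

/-- A standard tableau is determined by its content vector. -/
theorem IsSYT.eq_of_content_eq {μ : YoungDiagram} {f g : ℕ × ℕ → ℕ} (hf : IsSYT μ.cells f)
    (hg : IsSYT μ.cells g)
    (h : ∀ p ∈ μ.cells, ∀ q ∈ μ.cells, f p = g q → content p = content q) : f = g := by
  have key : ∀ k, ∀ p ∈ μ.cells, ∀ q ∈ μ.cells, f p = k → g q = k → p = q := by
    intro k
    induction k using Nat.strong_induction_on with
    | _ k ih =>
      intro p hp q hq hpk hqk
      have hc := h p hp q hq (hpk.trans hqk.symm)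
      unfold content at hc
      by_contra hne
      have hne' : ¬ (p.1 = q.1 ∧ p.2 = q.2) := fun e => hne (Prod.ext e.1 e.2)
      rcases lt_or_ge p.1 q.1 with hlt | hge
      · have hlt' : g p < k := by
          have := hg.add_dist_le_of_le (p := p) hq (by omega) (by omega)
          omega
        have hr := hg.isLabelling.1.mapsTo hp
        obtain ⟨r, hrs, hrf⟩ := hf.isLabelling.1.surjOn hr
        have := ih _ hlt' r hrs p hp hrf rfl
        subst this
        omega
      · have hlt' : f q < k := by
          have := hf.add_dist_le_of_le (p := q) hp (by omega) (by omega)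
          omega
        have hr := hf.isLabelling.1.mapsTo hq
        obtain ⟨r, hrs, hrf⟩ := hg.isLabelling.1.surjOn hr
        have := ih _ hlt' q hq r hrs rfl hrf
        subst this
        omega
  funext c
  by_cases hc : c ∈ μ.cells
  · obtain ⟨q, hq, hqc⟩ := hg.isLabelling.1.surjOn (hf.isLabelling.1.mapsTo hc)
    rw [← hqc, key _ c hc q hq rfl hqc]
  · rw [hf.2.2.2 c hc, hg.2.2.2 c hc]

/-- If `f ≠ g`, some admissible swap brings `f` closer to `g`. -/
theorem IsSYT.exists_descent {s : Finset (ℕ × ℕ)} {f g : ℕ × ℕ → ℕ} (hf : IsSYT s f)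
    (hg : IsSYT s g) (hne : f ≠ g) :
    ∃ p ∈ s, ∃ q ∈ s, f q = f p + 1 ∧ g q < g p := by
  by_contra hcon
  push Not at hcon
  have hfl := hf.isLabelling
  have hgl := hg.isLabelling
  have step : ∀ p ∈ s, ∀ q ∈ s, f q = f p + 1 → g p < g q := by
    intro p hp q hq h
    refine lt_of_le_of_ne (hcon p hp q hq h) fun e => ?_
    rw [hgl.eq_of_label_eq hp hq e] at h
    omega
  have hle : ∀ k, ∀ p ∈ s, f p = k → k ≤ g p := by
    intro k
    induction k with
    | zero => simp
    | succ k ih =>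
      intro p hp hpk
      rcases Nat.eq_zero_or_pos k with rfl | hk
      · exact (hgl.1.mapsTo hp).1
      · have := (hfl.1.mapsTo hp).2
        obtain ⟨r, hrs, hrf⟩ := hfl.1.surjOn (show k ∈ Set.Icc 1 s.card from ⟨hk, by omega⟩)
        have := step r hrs p hp (by omega)
        have := ih r hrs hrf
        omega
  have hsum : ∑ c ∈ s, f c = ∑ c ∈ s, g c := by
    have hb : ∀ {u : ℕ × ℕ → ℕ}, IsLabelling s u → ∑ c ∈ s, u c = ∑ j ∈ Finset.Icc 1 s.card, j := by
      intro u hu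
      refine Finset.sum_nbij u (fun c hc => ?_) hu.1.injOn ?_ (fun _ _ => rfl)
      · exact Finset.mem_Icc.2 (hu.1.mapsTo hc)
      · simpa using hu.1.surjOn
    rw [hb hfl, hb hgl]
  refine hne (funext fun c => ?_)
  by_cases hc : c ∈ s
  · exact (Finset.sum_eq_sum_iff_of_le fun d hd => hle _ d hd rfl).1 hsum c hc
  · rw [hfl.2 c hc, hgl.2 c hc]

theorem sum_swapS_mul_lt {s : Finset (ℕ × ℕ)} {f g : ℕ × ℕ → ℕ} (hf : IsLabelling s f)
    {p q : ℕ × ℕ} (hp : p ∈ s) (hq : q ∈ s) (h : f q = f p + 1) (hlt : g q < g p) :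
    ∑ c ∈ s, f c * g c < ∑ c ∈ s, swapS f (f p) c * g c := by
  have hpq : p ≠ q := by rintro rfl; omega
  have hq' : q ∈ s.erase p := Finset.mem_erase.2 ⟨hpq.symm, hq⟩
  rw [← Finset.add_sum_erase s _ hp, ← Finset.add_sum_erase _ _ hq',
    ← Finset.add_sum_erase s _ hp, ← Finset.add_sum_erase _ _ hq', swapS_of_eq rfl,
    swapS_of_eq_succ h, h]
  have hrest : ∑ c ∈ (s.erase p).erase q, swapS f (f p) c * g c
      = ∑ c ∈ (s.erase p).erase q, f c * g c := by
    refine Finset.sum_congr rfl fun c hc => ?_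
    simp only [Finset.mem_erase] at hc
    rw [swapS_of_ne rfl (fun e => hc.2.1 (hf.eq_of_label_eq hc.2.2 hp e))
      (fun e => hc.1 (hf.eq_of_label_eq hc.2.2 hq (e.trans h.symm)))]
  rw [hrest]
  nlinarith

/-- A property of standard tableaux which is stable under admissible swaps and holds for one
standard tableau holds for all of them. -/
theorem IsSYT.swap_connected {μ : YoungDiagram} {P : (ℕ × ℕ → ℕ) → Prop}
    (hP : ∀ f, IsSYT μ.cells f → P f → ∀ p ∈ μ.cells, ∀ q ∈ μ.cells, f q = f p + 1 →
      p.1 ≠ q.1 → p.2 ≠ q.2 → P (_root_.swapS f (f p)))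
    {f g : ℕ × ℕ → ℕ} (hf : IsSYT μ.cells f) (hg : IsSYT μ.cells g) (hPf : P f) : P g := by
  have hbound : ∀ u, IsLabelling μ.cells u →
      ∑ c ∈ μ.cells, u c * g c ≤ ∑ c ∈ μ.cells, μ.cells.card * g c := fun u hu =>
    Finset.sum_le_sum fun c hc => Nat.mul_le_mul_right _ (hu.1.mapsTo hc).2
  induction hm : ∑ c ∈ μ.cells, μ.cells.card * g c - ∑ c ∈ μ.cells, f c * g c
    using Nat.strong_induction_on generalizing f with
  | _ m ih =>
    by_cases hfg : f = g
    · exact hfg ▸ hPf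
    obtain ⟨p, hp, q, hq, h, hlt⟩ := hf.exists_descent hg hfg
    have hpos : p.1 ≠ q.1 ∧ p.2 ≠ q.2 := by
      rcases hf.consecutive hp hq h with ⟨h1, h2⟩ | ⟨h1, h2⟩ | h | h
      · have := hg.2.1 p hp q hq h1 h2
        omega
      · have := hg.2.2.1 p hp q hq h1 h2
        omega
      all_goals omega
    have hq2 := (hf.isLabelling.1.mapsTo hq).2
    have hf' : IsSYT μ.cells (_root_.swapS f (f p)) :=
      hf.swapS (hf.isLabelling.1.mapsTo hp).1 (h ▸ hq2) hp hq rfl h hpos.1 hpos.2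
    have hlt' := sum_swapS_mul_lt hf.isLabelling hp hq h hlt
    have := hbound _ hf'.isLabelling
    exact ih _ (by omega) hf' (hP f hf hPf p hp q hq h hpos.1 hpos.2) rfl

/-! ### Coefficients of the seminormal operators -/

theorem tV_ne_zero : tV ≠ 0 := RatFunc.X_ne_zero

theorem tV_pow_injective : Function.Injective fun k : ℕ => tV ^ k := by
  intro a b h
  have h' : algebraMap (Polynomial ℚ) Qt (Polynomial.X ^ a) =
      algebraMap (Polynomial ℚ) Qt (Polynomial.X ^ b) := by
    simpa [tV, RatFunc.algebraMap_X] using h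
  have := congrArg Polynomial.natDegree (RatFunc.algebraMap_injective ℚ h')
  simpa using this

theorem tV_zpow_injective : Function.Injective fun m : ℤ => tV ^ m := by
  intro m n h
  simp only at h
  wlog hmn : m ≤ n generalizing m n
  · exact (this h.symm (by omega)).symm
  obtain ⟨k, rfl⟩ := Int.le.dest hmn
  rw [zpow_add₀ tV_ne_zero, zpow_natCast] at h
  have h1 : tV ^ 0 = tV ^ k := by
    rw [pow_zero]
    exact mul_left_cancel₀ (zpow_ne_zero m tV_ne_zero) (by rw [mul_one]; exact h)
  have := tV_pow_injective h1
  omega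

/-- The power of `t` attached to a box. -/
noncomputable def boxWeight (p : ℕ × ℕ) : Qt := tV ^ content p

theorem boxWeight_sub_ne_zero {p q : ℕ × ℕ} (h : content p ≠ content q) :
    boxWeight p - boxWeight q ≠ 0 :=
  sub_ne_zero.2 fun e => h (tV_zpow_injective e)

theorem boxWeight_of_content_eq_add_one {p q : ℕ × ℕ} (h : content p = content q + 1) :
    boxWeight p = tV * boxWeight q := by
  rw [boxWeight, h, zpow_add_one₀ tV_ne_zero, mul_comm, boxWeight]

/-- The diagonal coefficient of `T_i` when `i`, `i + 1` label the boxes `p`, `q`. -/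
noncomputable def diagCoeff (p q : ℕ × ℕ) : Qt :=
  (1 - tV) * boxWeight p / (boxWeight p - boxWeight q)

/-- The product of the two off-diagonal coefficients attached to the boxes `p`, `q`. -/
noncomputable def offProd (p q : ℕ × ℕ) : Qt :=
  -((tV * boxWeight q - boxWeight p) * (tV * boxWeight p - boxWeight q) /
    (boxWeight q - boxWeight p) ^ 2)

/-- The off-diagonal coefficient of `T_i` when `i`, `i + 1` label the boxes `p`, `q`. -/
noncomputable def offCoeff (p q : ℕ × ℕ) : Qt :=
  if p.1 < q.1 ∨ (p.1 = q.1 ∧ p.2 < q.2) then 1 else offProd p q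

theorem offProd_comm (p q : ℕ × ℕ) : offProd p q = offProd q p := by
  unfold offProd
  ring

theorem offCoeff_mul_offCoeff {p q : ℕ × ℕ} (h : content p ≠ content q) :
    offCoeff p q * offCoeff q p = offProd p q := by
  have hne : ¬ (p.1 = q.1 ∧ p.2 = q.2) := fun e => h (by rw [Prod.ext e.1 e.2])
  unfold offCoeff
  by_cases h1 : p.1 < q.1 ∨ (p.1 = q.1 ∧ p.2 < q.2)
  · rw [if_pos h1, if_neg (by omega), one_mul, offProd_comm]
  · rw [if_neg h1, if_pos (by omega), mul_one]

theorem offCoeff_eq_zero {p q : ℕ × ℕ}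
    (h : (q.1 = p.1 ∧ q.2 + 1 = p.2) ∨ (q.1 + 1 = p.1 ∧ q.2 = p.2)) : offCoeff p q = 0 := by
  rw [offCoeff, if_neg (by omega), offProd]
  rcases h with h | h
  · rw [boxWeight_of_content_eq_add_one (p := p) (q := q) (by unfold content; omega)]
    simp
  · rw [boxWeight_of_content_eq_add_one (p := q) (q := p) (by unfold content; omega)]
    simp

theorem offProd_ne_zero {p q : ℕ × ℕ} (h : content p ≠ content q)
    (h1 : content p ≠ content q + 1) (h2 : content q ≠ content p + 1) : offProd p q ≠ 0 := by
  have key : ∀ p q : ℕ × ℕ, content p ≠ content q + 1 → tV * boxWeight q - boxWeight p ≠ 0 := by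
    intro p q hpq e
    refine hpq (tV_zpow_injective ?_)
    simp only [zpow_add_one₀ tV_ne_zero]
    unfold boxWeight at e
    linear_combination -e
  exact neg_ne_zero.2 (div_ne_zero (mul_ne_zero (key p q h1) (key q p h2))
    (pow_ne_zero 2 (boxWeight_sub_ne_zero h.symm)))

section CoefficientIdentities

variable {p q r : ℕ × ℕ}

theorem diagCoeff_add (h : content p ≠ content q) :
    diagCoeff p q + diagCoeff q p = 1 - tV := by
  have h1 := boxWeight_sub_ne_zero h
  have h2 := boxWeight_sub_ne_zero h.symm
  unfold diagCoeff
  field_simp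
  ring

theorem diagCoeff_quadratic (h : content p ≠ content q) :
    diagCoeff p q ^ 2 + offProd p q = (1 - tV) * diagCoeff p q + tV := by
  have h1 := boxWeight_sub_ne_zero h
  have h2 := boxWeight_sub_ne_zero h.symm
  unfold diagCoeff offProd
  field_simp
  ring

theorem diagCoeff_braid (hpq : content p ≠ content q) (hpr : content p ≠ content r)
    (hqr : content q ≠ content r) :
    diagCoeff p q * diagCoeff q r =
      diagCoeff p q * diagCoeff p r + diagCoeff p r * diagCoeff q r
        - (1 - tV) * diagCoeff p r := by
  have h1 := boxWeight_sub_ne_zero hpq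
  have h2 := boxWeight_sub_ne_zero hpr
  have h3 := boxWeight_sub_ne_zero hqr
  unfold diagCoeff
  field_simp
  ring

theorem diagCoeff_braid_diag (hpq : content p ≠ content q) (hpr : content p ≠ content r)
    (hqr : content q ≠ content r) :
    diagCoeff p q ^ 2 * diagCoeff q r + offProd p q * diagCoeff p r =
      diagCoeff q r ^ 2 * diagCoeff p q + offProd q r * diagCoeff p r := by
  linear_combination diagCoeff p r * diagCoeff_quadratic hpq
    - diagCoeff p r * diagCoeff_quadratic hqr
    + (diagCoeff p q - diagCoeff q r) * diagCoeff_braid hpq hpr hqr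

theorem diagCoeff_conj (h : content p ≠ content q) :
    (diagCoeff p q - (1 - tV)) * boxWeight p +
      (diagCoeff q p - (1 - tV)) * boxWeight q = 0 := by
  have h1 := boxWeight_sub_ne_zero h
  have h2 := boxWeight_sub_ne_zero h.symm
  unfold diagCoeff
  field_simp
  ring

theorem diagCoeff_conj_diag (h : content p ≠ content q) :
    (diagCoeff p q - (1 - tV)) ^ 2 * boxWeight p + offProd p q * boxWeight q =
      tV * boxWeight q := by
  have h1 := boxWeight_sub_ne_zero h
  have h2 := boxWeight_sub_ne_zero h.symm
  unfold diagCoeff offProd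
  field_simp
  ring

end CoefficientIdentities

/-! ### The seminormal operators on labellings -/

/-- The basis vector attached to a standard tableau, and `0` for any other function. -/
noncomputable def tabVec (s : Finset (ℕ × ℕ)) (f : ℕ × ℕ → ℕ) : Vsp s :=
  if h : IsSYT s f then Finsupp.single ⟨f, h⟩ 1 else 0

theorem tabVec_of_isSYT {s : Finset (ℕ × ℕ)} {f : ℕ × ℕ → ℕ} (h : IsSYT s f) :
    tabVec s f = Finsupp.single (⟨f, h⟩ : SYTt s) 1 := dif_pos h

theorem tabVec_of_not_isSYT {s : Finset (ℕ × ℕ)} {f : ℕ × ℕ → ℕ} (h : ¬ IsSYT s f) :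
    tabVec s f = 0 := dif_neg h

theorem linearMap_ext_tabVec {s : Finset (ℕ × ℕ)} {φ ψ : Module.End Qt (Vsp s)}
    (h : ∀ f, IsSYT s f → φ (tabVec s f) = ψ (tabVec s f)) : φ = ψ := by
  refine Finsupp.lhom_ext' fun τ => LinearMap.ext_ring ?_
  simpa [tabVec_of_isSYT τ.2] using h τ.1 τ.2

theorem heckeT_single (s : Finset (ℕ × ℕ)) (i : ℕ) (τ : SYTt s) :
    heckeT s i (Finsupp.single τ 1) = Tact s i τ := by
  simp [heckeT, Finsupp.lift_apply]

/-- The uniform description of `T_i`: it also holds when one of the two labellings involved is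
not standard, because the corresponding off-diagonal coefficient vanishes. -/
theorem heckeT_tabVec {μ : YoungDiagram} {f : ℕ × ℕ → ℕ} (hf : IsLabelling μ.cells f)
    {p q : ℕ × ℕ} (hp : p ∈ μ.cells) (hq : q ∈ μ.cells) {i : ℕ} (hpi : f p = i)
    (hqi : f q = i + 1) (hc : content p ≠ content q) :
    heckeT μ.cells i (tabVec μ.cells f) =
      diagCoeff p q • tabVec μ.cells f + offCoeff p q • tabVec μ.cells (swapS f i) := by
  have hi1 : 1 ≤ i := hpi ▸ (hf.1.mapsTo hp).1
  have hi2 : i + 1 ≤ μ.cells.card := hqi ▸ (hf.1.mapsTo hq).2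
  have hsp := swapS_of_eq hpi
  have hsq := swapS_of_eq_succ hqi
  have hw := boxWeight_sub_ne_zero hc
  by_cases hstd : IsSYT μ.cells f
  · rw [tabVec_of_isSYT hstd, heckeT_single, Tact]
    simp only [hf.theBoxS_eq hp hpi, hf.theBoxS_eq hq hqi]
    rcases hstd.consecutive hp hq (by omega) with h | h | h | h
    · have hns : ¬ IsSYT μ.cells (swapS f i) := fun hs => by
        have := hs.2.1 p hp q hq h.1 h.2
        omega
      have hb := boxWeight_of_content_eq_add_one (p := q) (q := p) (by unfold content; omega)
      have hA : diagCoeff p q = 1 := by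
        rw [hb] at hw
        rw [diagCoeff, hb, div_eq_one_iff_eq hw]
        ring
      rw [if_pos h.1, tabVec_of_not_isSYT hns, hA]
      simp
    · have hns : ¬ IsSYT μ.cells (swapS f i) := fun hs => by
        have := hs.2.2.1 p hp q hq h.1 h.2
        omega
      have hb := boxWeight_of_content_eq_add_one (p := p) (q := q) (by unfold content; omega)
      have hA : diagCoeff p q = -tV := by
        rw [hb] at hw
        rw [diagCoeff, hb, div_eq_iff hw]
        ring
      rw [if_neg (by omega), if_pos h.2, tabVec_of_not_isSYT hns, hA]
      simp
    · have hs := hstd.swapS hi1 hi2 hp hq hpi hqi (by omega) (by omega)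
      have h1 : 1 < content p - content q := by unfold content; omega
      have hB : offCoeff p q = 1 := if_pos (by omega)
      rw [if_neg (by omega), if_neg (by omega), dif_pos hs, if_pos h1, tabVec_of_isSYT hs, hB,
        add_comm, diagCoeff]
      simp [boxWeight]
    · have hs := hstd.swapS hi1 hi2 hp hq hpi hqi (by omega) (by omega)
      have h1 : ¬ 1 < content p - content q := by unfold content; omega
      have hB : offCoeff p q = offProd p q := if_neg (by omega)
      rw [if_neg (by omega), if_neg (by omega), dif_pos hs, if_neg h1, tabVec_of_isSYT hs, hB,
        add_comm, diagCoeff, offProd]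
      simp [boxWeight, zpow_add_one₀ tV_ne_zero, mul_comm]
  · rw [tabVec_of_not_isSYT hstd, map_zero, smul_zero, zero_add]
    by_cases hs : IsSYT μ.cells (swapS f i)
    · have hB : offCoeff p q = 0 := by
        refine offCoeff_eq_zero ?_
        have h' : ¬ (q.1 ≠ p.1 ∧ q.2 ≠ p.2) := fun h => hstd <| by
          simpa [swapS_swapS] using hs.swapS hi1 hi2 hq hp hsq hsp h.1 h.2
        have := hs.consecutive hq hp (by omega)
        omega
      rw [hB, zero_smul]
    · rw [tabVec_of_not_isSYT hs, smul_zero]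

theorem IsLabelling.exists_box {s : Finset (ℕ × ℕ)} {f : ℕ × ℕ → ℕ} (hf : IsLabelling s f)
    {j : ℕ} (h1 : 1 ≤ j) (h2 : j ≤ s.card) : ∃ p ∈ s, f p = j :=
  hf.1.surjOn ⟨h1, h2⟩

theorem heckeT_quadratic (μ : YoungDiagram) {i : ℕ} (h1 : 1 ≤ i) (h2 : i + 1 ≤ μ.cells.card) :
    (heckeT μ.cells i - 1) * (heckeT μ.cells i + tV • 1) = 0 := by
  let : Algebra ℕ Qt := Semiring.toNatAlgebra
  let : Algebra ℤ Qt := Ring.toIntAlgebra _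
  refine linearMap_ext_tabVec fun f hf => ?_
  have hl := hf.isLabelling
  obtain ⟨p, hp, hpi⟩ := hl.exists_box h1 (by omega)
  obtain ⟨q, hq, hqi⟩ := hl.exists_box (j := i + 1) (by omega) h2
  have hc := hf.content_ne_of_succ hp hq (by omega)
  have e1 := heckeT_tabVec hl hp hq hpi hqi hc
  have e2 := heckeT_tabVec (hl.swapS h1 h2) hq hp (swapS_of_eq_succ hqi) (swapS_of_eq hpi) hc.symm
  rw [swapS_swapS] at e2
  have hA := diagCoeff_add hc
  have hQ := diagCoeff_quadratic hc
  have hB := offCoeff_mul_offCoeff hc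
  simp only [Module.End.mul_apply, LinearMap.add_apply, LinearMap.sub_apply, LinearMap.smul_apply,
    Module.End.one_apply, LinearMap.zero_apply, map_add, map_smul, e1, e2]
  match_scalars
  · linear_combination hQ + hB
  · linear_combination offCoeff p q * hA

theorem heckeT_braid (μ : YoungDiagram) {i : ℕ} (h1 : 1 ≤ i) (h2 : i + 2 ≤ μ.cells.card) :
    heckeT μ.cells i * heckeT μ.cells (i + 1) * heckeT μ.cells i =
      heckeT μ.cells (i + 1) * heckeT μ.cells i * heckeT μ.cells (i + 1) := by
  let : Algebra ℕ Qt := Semiring.toNatAlgebra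
  let : Algebra ℤ Qt := Ring.toIntAlgebra _
  refine linearMap_ext_tabVec fun f hf => ?_
  have hl := hf.isLabelling
  obtain ⟨p, hp, hpi⟩ := hl.exists_box h1 (by omega)
  obtain ⟨q, hq, hqi⟩ := hl.exists_box (j := i + 1) (by omega) (by omega)
  obtain ⟨r, hr, hri⟩ := hl.exists_box (j := i + 1 + 1) (by omega) h2
  have hpq := hf.content_ne_of_succ hp hq (by omega)
  have hqr := hf.content_ne_of_succ hq hr (by omega)
  have hpr := hf.content_ne_of_add_two hp hr (by omega)
  have hl1 := hl.swapS h1 (by omega)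
  have hl2 := hl.swapS (i := i + 1) (by omega) h2
  have hl12 := hl1.swapS (i := i + 1) (by omega) h2
  have hl21 := hl2.swapS h1 (by omega)
  have p1 := swapS_of_eq hpi
  have q1 := swapS_of_eq_succ hqi
  have r1 := swapS_of_ne (i := i) hri (by omega) (by omega)
  have p2 := swapS_of_ne (i := i + 1) hpi (by omega) (by omega)
  have q2 := swapS_of_eq hqi
  have r2 := swapS_of_eq_succ hri
  have q12 := swapS_of_ne (i := i + 1) q1 (by omega) (by omega)
  have r12 := swapS_of_eq_succ r1
  have p21 := swapS_of_eq p2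
  have q21 := swapS_of_ne (i := i) q2 (by omega) (by omega)
  have a0 := heckeT_tabVec hl hp hq hpi hqi hpq
  have b0 := heckeT_tabVec hl hq hr hqi hri hqr
  have a1 := heckeT_tabVec hl1 hq hp q1 p1 hpq.symm
  have b1 := heckeT_tabVec hl1 hp hr p1 r1 hpr
  have a2 := heckeT_tabVec hl2 hp hr p2 r2 hpr
  have b2 := heckeT_tabVec hl2 hr hq r2 q2 hqr.symm
  have a12 := heckeT_tabVec hl12 hq hr q12 r12 hqr
  have b21 := heckeT_tabVec hl21 hp hq p21 q21 hpq
  rw [swapS_swapS] at a1 b2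
  rw [swapS_braid] at a12
  have hA := diagCoeff_braid hpq hpr hqr
  have hD := diagCoeff_braid_diag hpq hpr hqr
  have hB1 := offCoeff_mul_offCoeff hpq
  have hB2 := offCoeff_mul_offCoeff hqr
  have hS1 := diagCoeff_add hpq
  have hS2 := diagCoeff_add hqr
  simp only [Module.End.mul_apply, map_add, map_smul, a0, b0, a1, b1, a2, b2, a12, b21]
  match_scalars
  · linear_combination hD + diagCoeff p r * hB1 - diagCoeff p r * hB2
  · linear_combination offCoeff p q * (hA + diagCoeff p r * hS1)
  · linear_combination -offCoeff q r * (hA + diagCoeff p r * hS2)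
  all_goals ring

theorem heckeT_comm (μ : YoungDiagram) {i j : ℕ} (hi1 : 1 ≤ i) (hi2 : i + 1 ≤ μ.cells.card)
    (hj1 : 1 ≤ j) (hj2 : j + 1 ≤ μ.cells.card) (hij : i + 1 < j ∨ j + 1 < i) :
    heckeT μ.cells i * heckeT μ.cells j = heckeT μ.cells j * heckeT μ.cells i := by
  let : Algebra ℕ Qt := Semiring.toNatAlgebra
  let : Algebra ℤ Qt := Ring.toIntAlgebra _
  refine linearMap_ext_tabVec fun f hf => ?_
  have hl := hf.isLabelling
  obtain ⟨p, hp, hpi⟩ := hl.exists_box hi1 (by omega)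
  obtain ⟨q, hq, hqi⟩ := hl.exists_box (j := i + 1) (by omega) hi2
  obtain ⟨x, hx, hxj⟩ := hl.exists_box hj1 (by omega)
  obtain ⟨y, hy, hyj⟩ := hl.exists_box (j := j + 1) (by omega) hj2
  have hpq := hf.content_ne_of_succ hp hq (by omega)
  have hxy := hf.content_ne_of_succ hx hy (by omega)
  have a0 := heckeT_tabVec hl hp hq hpi hqi hpq
  have b0 := heckeT_tabVec hl hx hy hxj hyj hxy
  have a1 := heckeT_tabVec (hl.swapS hj1 hj2) hp hq (swapS_of_ne hpi (by omega) (by omega))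
    (swapS_of_ne hqi (by omega) (by omega)) hpq
  have b1 := heckeT_tabVec (hl.swapS hi1 hi2) hx hy (swapS_of_ne hxj (by omega) (by omega))
    (swapS_of_ne hyj (by omega) (by omega)) hxy
  rw [swapS_comm f hij] at b1
  simp only [Module.End.mul_apply, map_add, map_smul, a0, b0, a1, b1]
  module

/-- The inverse of `T_i` given by the quadratic relation. -/
noncomputable def heckeInv (s : Finset (ℕ × ℕ)) (i : ℕ) : Module.End Qt (Vsp s) :=
  tV⁻¹ • (heckeT s i + (tV - 1) • 1)

theorem heckeT_mul_heckeInv (μ : YoungDiagram) {i : ℕ} (h1 : 1 ≤ i)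
    (h2 : i + 1 ≤ μ.cells.card) : heckeT μ.cells i * heckeInv μ.cells i = 1 := by
  let : Algebra ℕ Qt := Semiring.toNatAlgebra
  let : Algebra ℤ Qt := Ring.toIntAlgebra _
  have hquad := heckeT_quadratic μ h1 h2
  have h : heckeT μ.cells i * (heckeT μ.cells i + (tV - 1) • 1) = tV • 1 := by
    ext1 τ
    ext1
    have hv := LinearMap.congr_fun hquad (Finsupp.single τ 1)
    simp only [Module.End.mul_apply, LinearMap.add_apply, LinearMap.sub_apply,
      LinearMap.smul_apply, Module.End.one_apply, LinearMap.zero_apply, map_add, map_smul,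
      LinearMap.comp_apply, Finsupp.lsingle_apply] at hv ⊢
    rw [← sub_eq_zero, ← hv]
    module
  rw [heckeInv, mul_smul_comm, h, smul_smul, inv_mul_cancel₀ tV_ne_zero, one_smul]

theorem heckeInv_mul_heckeT (μ : YoungDiagram) {i : ℕ} (h1 : 1 ≤ i)
    (h2 : i + 1 ≤ μ.cells.card) : heckeInv μ.cells i * heckeT μ.cells i = 1 := by
  rw [← heckeT_mul_heckeInv μ h1 h2, heckeInv, smul_mul_assoc, mul_smul_comm, add_mul, mul_add,
    smul_mul_assoc, mul_smul_comm, one_mul, mul_one]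

/-! ### Jucys–Murphy elements -/

theorem thetaBar_tabVec {μ : YoungDiagram} {S : ℕ → Module.End Qt (Vsp μ.cells)}
    (hS : ∀ i, 1 ≤ i → i + 1 ≤ μ.cells.card →
      heckeT μ.cells i * S i = 1 ∧ S i * heckeT μ.cells i = 1)
    {k : ℕ} {f : ℕ × ℕ → ℕ} {p : ℕ × ℕ} (hp : p ∈ μ.cells) (hpk : f p = k + 1) :
    thetaBar S k (tabVec μ.cells f) = boxWeight p • tabVec μ.cells f := by
  let : Algebra ℕ Qt := Semiring.toNatAlgebra
  induction k generalizing f p with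
  | zero =>
    by_cases hf : IsSYT μ.cells f
    · rw [hf.box_one hp hpk]
      simp [thetaBar, boxWeight, content]
    · simp [tabVec_of_not_isSYT hf]
  | succ k ih =>
    by_cases hf : IsSYT μ.cells f
    · have hl := hf.isLabelling
      have hk : k + 1 + 1 ≤ μ.cells.card := hpk ▸ (hl.1.mapsTo hp).2
      have hk1 : 1 ≤ k + 1 := by omega
      obtain ⟨q, hq, hqk⟩ := hl.exists_box hk1 (by omega)
      have hc := hf.content_ne_of_succ hq hp (by omega)
      have hSk : S (k + 1) = heckeInv μ.cells (k + 1) :=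
        left_inv_eq_right_inv (hS (k + 1) hk1 hk).2 (heckeT_mul_heckeInv μ hk1 hk)
      have hsp := swapS_of_eq_succ hpk
      have e1 := heckeT_tabVec hl hq hp hqk hpk hc
      have e2 := heckeT_tabVec (hl.swapS hk1 hk) hp hq hsp (swapS_of_eq hqk) hc.symm
      rw [swapS_swapS] at e2
      have d1 := ih hq hqk
      have d2 := ih hp hsp
      have hB := offCoeff_mul_offCoeff hc
      have hA := diagCoeff_conj hc
      have hD := diagCoeff_conj_diag hc
      have ht : tV * tV⁻¹ = 1 := mul_inv_cancel₀ tV_ne_zero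
      simp only [thetaBar, hSk, heckeInv, LinearMap.smul_apply, Module.End.mul_apply,
        LinearMap.add_apply, Module.End.one_apply, map_add, map_smul, e1, e2, d1, d2]
      match_scalars
      · linear_combination tV * tV⁻¹ ^ 2 * (hD + boxWeight p * hB) +
          (tV * tV⁻¹ + 1) * boxWeight p * ht
      · linear_combination tV * tV⁻¹ ^ 2 * offCoeff q p * hA
    · simp [tabVec_of_not_isSYT hf]

/-! ### Irreducibility -/

theorem exists_single_mem_of_separated {ι J K : Type*} [Field K] {U : Submodule K (ι →₀ K)}
    (D : J → Module.End K (ι →₀ K)) (w : J → ι → K)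
    (hD : ∀ j a, D j (Finsupp.single a 1) = w j a • Finsupp.single a 1)
    (hU : ∀ j, ∀ x ∈ U, D j x ∈ U) (hsep : ∀ a b, a ≠ b → ∃ j, w j a ≠ w j b) (hne : U ≠ ⊥) :
    ∃ a, Finsupp.single a 1 ∈ U := by
  have hcoord : ∀ j v a, D j v a = w j a * v a := by
    intro j v a
    induction v using Finsupp.induction_linear with
    | zero => simp
    | add v v' h h' => simp [h, h', mul_add]
    | single b c =>
      rw [← mul_one c, ← smul_eq_mul, ← Finsupp.smul_single, map_smul, hD]
      by_cases hab : b = a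
      · subst hab
        simp [mul_comm]
      · simp [hab]
  obtain ⟨v, hvU, hv0⟩ := U.ne_bot_iff.1 hne
  induction hm : v.support.card using Nat.strong_induction_on generalizing v with
  | _ m ih =>
    obtain ⟨a, ha⟩ := Finsupp.support_nonempty_iff.2 hv0
    by_cases hsub : v.support ⊆ {a}
    · refine ⟨a, ?_⟩
      obtain ⟨c, rfl⟩ := Finsupp.support_subset_singleton'.1 hsub
      have hc : c ≠ 0 := by simpa using ha
      have := U.smul_mem c⁻¹ hvU
      rwa [Finsupp.smul_single, smul_eq_mul, inv_mul_cancel₀ hc] at this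
    · obtain ⟨b, hb, hba⟩ := Finset.not_subset.1 hsub
      obtain ⟨j, hj⟩ := hsep a b fun e => hba (by simp [e])
      have hcoord' : ∀ d, (D j v - w j b • v) d = (w j d - w j b) * v d := fun d => by
        simp [hcoord, sub_mul]
      refine ih _ ?_ (D j v - w j b • v) (U.sub_mem (hU j v hvU) (U.smul_mem _ hvU)) ?_ rfl
      · rw [← hm]
        refine Finset.card_lt_card (Finset.ssubset_iff_of_subset (fun d hd => ?_) |>.2 ⟨b, hb, ?_⟩)
        · rw [Finsupp.mem_support_iff, hcoord'] at hd
          exact Finsupp.mem_support_iff.2 (right_ne_zero_of_mul hd)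
        · simp [hcoord']
      · intro e
        have := hcoord' a
        rw [e, Finsupp.zero_apply, eq_comm, mul_eq_zero, sub_eq_zero] at this
        exact this.elim hj (Finsupp.mem_support_iff.1 ha)

theorem thetaBar_mem {s : Finset (ℕ × ℕ)} {S : ℕ → Module.End Qt (Vsp s)}
    {U : Submodule Qt (Vsp s)} {k : ℕ}
    (hS : ∀ i, 1 ≤ i → i ≤ k → ∀ x ∈ U, S i x ∈ U) :
    ∀ x ∈ U, thetaBar S k x ∈ U := by
  induction k with
  | zero => exact fun x hx => hx
  | succ k ih =>
    intro x hx
    have hSk := hS (k + 1) (by omega) le_rfl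
    exact U.smul_mem _ (hSk _ (ih (fun i h1 h2 => hS i h1 (by omega)) _ (hSk x hx)))

theorem heckeT_irreducible (μ : YoungDiagram) (U : Submodule Qt (Vsp μ.cells))
    (hU : ∀ i, 1 ≤ i → i + 1 ≤ μ.cells.card → ∀ x ∈ U, heckeT μ.cells i x ∈ U) :
    U = ⊥ ∨ U = ⊤ := by
  refine or_iff_not_imp_left.2 fun hne => ?_
  have hinv : ∀ i, 1 ≤ i → i + 1 ≤ μ.cells.card → ∀ x ∈ U, heckeInv μ.cells i x ∈ U :=
    fun i h1 h2 x hx => U.smul_mem _ (U.add_mem (hU i h1 h2 x hx) (U.smul_mem _ hx))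
  obtain ⟨τ, hτ⟩ : ∃ τ : SYTt μ.cells, Finsupp.single τ 1 ∈ U := by
    refine exists_single_mem_of_separated
      (fun k : Fin μ.cells.card => thetaBar (heckeInv μ.cells) k)
      (fun k τ => boxWeight (theBoxS μ.cells τ.1 (k + 1))) (fun k τ => ?_) (fun k => ?_)
      (fun σ τ hστ => ?_) hne
    · obtain ⟨p, hp, hpk⟩ := τ.2.isLabelling.exists_box (j := k + 1) (by omega) k.2
      rw [τ.2.isLabelling.theBoxS_eq hp hpk]
      simpa only [tabVec_of_isSYT τ.2] using thetaBar_tabVec (fun i h1 h2 =>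
        ⟨heckeT_mul_heckeInv μ h1 h2, heckeInv_mul_heckeT μ h1 h2⟩) hp hpk
    · exact thetaBar_mem fun i h1 h2 => hinv i h1 (by omega)
    · by_contra! hcon
      refine hστ (Subtype.ext (σ.2.eq_of_content_eq τ.2 fun p hp q hq hpq => ?_))
      obtain ⟨h1, h2⟩ := σ.2.isLabelling.1.mapsTo hp
      have := hcon ⟨σ.1 p - 1, by omega⟩
      rw [Nat.sub_add_cancel h1, σ.2.isLabelling.theBoxS_eq hp rfl,
        τ.2.isLabelling.theBoxS_eq hq hpq.symm] at this
      exact tV_zpow_injective this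
  have hall : ∀ g, IsSYT μ.cells g → tabVec μ.cells g ∈ U := by
    intro g hg
    refine IsSYT.swap_connected (P := fun f => tabVec μ.cells f ∈ U) ?_ τ.2 hg
      (by rwa [tabVec_of_isSYT τ.2])
    intro f hf hfU p hp q hq h hr hcol
    have hl := hf.isLabelling
    have hc := hf.content_ne_of_succ hp hq h
    have hcons := hf.consecutive hp hq h
    have hB : offCoeff p q ≠ 0 := by
      refine left_ne_zero_of_mul (b := offCoeff q p) ?_
      rw [offCoeff_mul_offCoeff hc]
      refine offProd_ne_zero hc ?_ ?_ <;>
      · unfold content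
        omega
    have hT := hU (f p) (hl.1.mapsTo hp).1 (h ▸ (hl.1.mapsTo hq).2) _ hfU
    rw [heckeT_tabVec hl hp hq rfl h hc] at hT
    exact (U.smul_mem_iff hB).1 ((U.add_mem_iff_right (U.smul_mem _ hfU)).1 hT)
  refine eq_top_iff.2 fun v _ => ?_
  induction v using Finsupp.induction_linear with
  | zero => exact U.zero_mem
  | add v w hv hw => exact U.add_mem (hv trivial) (hw trivial)
  | single τ c =>
    have := U.smul_mem c (hall τ.1 τ.2)
    rwa [tabVec_of_isSYT τ.2, Finsupp.smul_single, smul_eq_mul, mul_one] at this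

/-- Let `λ` be a partition of `n`. The seminormal operators
`T_1, …, T_{n−1}` on `V_λ` satisfy the finite Hecke algebra relations, each `T_i` is
invertible, the elements `θ̄_i` built from the inverses satisfy
`θ̄_i e_τ = t^{c_τ(i)} e_τ`, and the only subspaces of `V_λ` invariant under all the
`T_i` are `0` and `V_λ`. -/
theorem statement2 (μ : YoungDiagram) (n : ℕ) (hn : μ.card = n) :
    -- quadratic relations
    (∀ i, 1 ≤ i → i + 1 ≤ n →
      (heckeT μ.cells i - 1) * (heckeT μ.cells i + tV • 1) = 0) ∧
    -- braid relations
    (∀ i, 1 ≤ i → i + 2 ≤ n →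
      heckeT μ.cells i * heckeT μ.cells (i + 1) * heckeT μ.cells i =
        heckeT μ.cells (i + 1) * heckeT μ.cells i * heckeT μ.cells (i + 1)) ∧
    -- commutation relations
    (∀ i j, 1 ≤ i → i + 1 ≤ n → 1 ≤ j → j + 1 ≤ n → (i + 1 < j ∨ j + 1 < i) →
      heckeT μ.cells i * heckeT μ.cells j = heckeT μ.cells j * heckeT μ.cells i) ∧
    -- invertibility
    (∀ i, 1 ≤ i → i + 1 ≤ n → IsUnit (heckeT μ.cells i)) ∧
    -- Jucys–Murphy eigenvalues
    (∀ S : ℕ → Module.End Qt (Vsp μ.cells),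
      (∀ i, 1 ≤ i → i + 1 ≤ n → heckeT μ.cells i * S i = 1 ∧ S i * heckeT μ.cells i = 1) →
      ∀ i, 1 ≤ i → i ≤ n → ∀ τ : SYTt μ.cells,
        thetaBar S (i - 1) (Finsupp.single τ 1) =
          tV ^ content (theBoxS μ.cells τ.1 i) • Finsupp.single τ (1 : Qt)) ∧
    -- irreducibility
    (∀ U : Submodule Qt (Vsp μ.cells),
      (∀ i, 1 ≤ i → i + 1 ≤ n → ∀ x ∈ U, heckeT μ.cells i x ∈ U) → U = ⊥ ∨ U = ⊤) := by
  subst hn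
  refine ⟨fun i => heckeT_quadratic μ, fun i => heckeT_braid μ, fun i j => heckeT_comm μ,
    fun i h1 h2 => ⟨⟨_, _, heckeT_mul_heckeInv μ h1 h2, heckeInv_mul_heckeT μ h1 h2⟩, rfl⟩,
    fun S hS i h1 h2 τ => ?_, heckeT_irreducible μ⟩
  obtain ⟨p, hp, hpi⟩ := τ.2.isLabelling.exists_box h1 h2
  rw [τ.2.isLabelling.theBoxS_eq hp hpi]
  simpa only [tabVec_of_isSYT τ.2, boxWeight] using
    thetaBar_tabVec hS (k := i - 1) (f := τ.1) hp (by omega)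
end

section
/- Let M be a monoid and T_1,…,T_{n−1} ∈ M elements satisfying the braid relations T_jT_{j+1}T_j = T_{j+1}T_jT_{j+1} for 1 ≤ j ≤ n−2 and T_jT_k = T_kT_j for |j−k| > 1. For 1 ≤ j ≤ n set Θ_j := (T_{j−1}T_{j−2}⋯T_1)(T_1T_2⋯T_{j−1}) (so Θ_1 = 1). Then for every 1 ≤ i ≤ n: Θ_i·Θ_{i−1}·⋯·Θ_1 = (T_{i−1}T_{i−2}⋯T_1)^i. -/
/-- The descending product `f b * f (b-1) * ⋯ * f a` (equal to `1` when `b + 1 ≤ a`). -/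
def descProd {M : Type*} [Monoid M] (f : ℕ → M) (a b : ℕ) : M :=
  (((List.range (b + 1 - a)).reverse).map fun k => f (a + k)).prod

/-- The ascending product `f a * f (a+1) * ⋯ * f b` (equal to `1` when `b + 1 ≤ a`). -/
def ascProd {M : Type*} [Monoid M] (f : ℕ → M) (a b : ℕ) : M :=
  ((List.range (b + 1 - a)).map fun k => f (a + k)).prod

theorem descProd_one_zero {M : Type*} [Monoid M] (f : ℕ → M) : descProd f 1 0 = 1 := by
  simp [descProd]

theorem descProd_one_succ {M : Type*} [Monoid M] (f : ℕ → M) (m : ℕ) :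
    descProd f 1 (m + 1) = f (m + 1) * descProd f 1 m := by
  simp [descProd, List.range_succ, Nat.add_comm 1 m]

theorem ascProd_succ_self {M : Type*} [Monoid M] (f : ℕ → M) (b : ℕ) :
    ascProd f (b + 1) b = 1 := by
  simp [ascProd]

theorem ascProd_succ_right {M : Type*} [Monoid M] (f : ℕ → M) {a b : ℕ} (h : a ≤ b + 1) :
    ascProd f a (b + 1) = ascProd f a b * f (b + 1) := by
  have h₁ : b + 1 + 1 - a = (b + 1 - a) + 1 := by omega
  have h₂ : a + (b + 1 - a) = b + 1 := by omega
  simp [ascProd, h₁, List.range_succ, h₂]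

theorem SemiconjBy.ascProd_succ {M : Type*} [Monoid M] {f : ℕ → M} {x : M} {a b : ℕ}
    (hab : a ≤ b + 1) (h : ∀ k, a ≤ k → k ≤ b → SemiconjBy x (f (k + 1)) (f k)) :
    SemiconjBy x (ascProd f (a + 1) (b + 1)) (ascProd f a b) := by
  induction b with
  | zero =>
    obtain rfl | rfl : a = 0 ∨ a = 1 := by omega
    · simpa [ascProd] using h 0 le_rfl le_rfl
    · simp [ascProd]
  | succ b ih =>
    obtain rfl | hab' : a = b + 2 ∨ a ≤ b + 1 := by omega
    · rw [ascProd_succ_self, ascProd_succ_self]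
      exact SemiconjBy.one_right x
    · rw [ascProd_succ_right f (by omega : a + 1 ≤ b + 1 + 1), ascProd_succ_right f hab']
      exact (ih hab' fun k h₁ h₂ => h k h₁ (by omega)).mul_right (h (b + 1) hab' le_rfl)

theorem Commute.descProd_one_left {M : Type*} [Monoid M] {f : ℕ → M} {x : M} {m : ℕ}
    (h : ∀ k, 1 ≤ k → k ≤ m → Commute (f k) x) : Commute (descProd f 1 m) x := by
  induction m with
  | zero => rw [descProd_one_zero]; exact Commute.one_left x
  | succ m ih =>
    rw [descProd_one_succ]
    exact (h (m + 1) (by omega) le_rfl).mul_left (ih fun k h₁ h₂ => h k h₁ (by omega))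

section Braid

variable {M : Type*} [Monoid M] {n : ℕ} {T : ℕ → M}

/-- Conjugation by the Coxeter element `T m ⋯ T 1` lowers the index of a braid generator. -/
theorem semiconjBy_descProd_of_braid
    (hbraid : ∀ j, 1 ≤ j → j + 2 ≤ n → T j * T (j + 1) * T j = T (j + 1) * T j * T (j + 1))
    (hcomm : ∀ j k, 1 ≤ j → j + 1 ≤ n → 1 ≤ k → k + 1 ≤ n → (j + 1 < k ∨ k + 1 < j) →
      T j * T k = T k * T j)
    {m j : ℕ} (hm : m + 1 ≤ n) (hj : 1 ≤ j) (hjm : j + 1 ≤ m) :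
    SemiconjBy (descProd T 1 m) (T (j + 1)) (T j) := by
  induction m with
  | zero => omega
  | succ m ih =>
    rw [descProd_one_succ]
    obtain hlt | rfl : j + 1 ≤ m ∨ j = m := by omega
    · have hc : Commute (T (m + 1)) (T j) :=
        hcomm _ _ (by omega) (by omega) hj (by omega) (by omega)
      exact hc.semiconjBy.mul_left (ih (by omega) hlt)
    · obtain ⟨p, rfl⟩ : ∃ p, j = p + 1 := ⟨j - 1, by omega⟩
      have hc : Commute (descProd T 1 p) (T (p + 1 + 1)) :=
        Commute.descProd_one_left fun k h₁ h₂ =>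
          hcomm _ _ h₁ (by omega) (by omega) (by omega) (by omega)
      have hb : SemiconjBy (T (p + 1 + 1) * T (p + 1)) (T (p + 1 + 1)) (T (p + 1)) := by
        rw [SemiconjBy, ← hbraid (p + 1) hj (by omega), mul_assoc]
      rw [descProd_one_succ, ← mul_assoc]
      exact hb.mul_left hc.semiconjBy

theorem descProd_pow_eq_ascProd_mul
    (hbraid : ∀ j, 1 ≤ j → j + 2 ≤ n → T j * T (j + 1) * T j = T (j + 1) * T j * T (j + 1))
    (hcomm : ∀ j k, 1 ≤ j → j + 1 ≤ n → 1 ≤ k → k + 1 ≤ n → (j + 1 < k ∨ k + 1 < j) →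
      T j * T k = T k * T j)
    {m : ℕ} (hm : m + 2 ≤ n) (k a : ℕ) (ha : 1 ≤ a) (hak : a + k = m + 2) :
    descProd T 1 (m + 1) ^ k = ascProd T a (m + 1) * descProd T 1 m ^ k := by
  induction k generalizing a with
  | zero =>
    obtain rfl : a = m + 2 := by omega
    rw [ascProd_succ_self, pow_zero, pow_zero, one_mul]
  | succ k ih =>
    have hs : SemiconjBy (descProd T 1 (m + 1)) (ascProd T (a + 1) (m + 1)) (ascProd T a m) :=
      SemiconjBy.ascProd_succ (by omega) fun j h₁ h₂ =>
        semiconjBy_descProd_of_braid hbraid hcomm hm (by omega) (by omega)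
    rw [pow_succ', ih (a + 1) (by omega) (by omega), ← mul_assoc, hs.eq, descProd_one_succ,
      ascProd_succ_right T (by omega), pow_succ']
    simp only [mul_assoc]

end Braid

/-- If `T 1, …, T (n-1)` satisfy the braid relations in a monoid `M`, and
`Θ j := (T (j-1) ⋯ T 1) * (T 1 ⋯ T (j-1))` (so `Θ 1 = 1`), then for every `1 ≤ i ≤ n` one has
`Θ i * Θ (i-1) * ⋯ * Θ 1 = (T (i-1) * T (i-2) * ⋯ * T 1) ^ i`. -/
theorem statement7 {M : Type*} [Monoid M] (n : ℕ) (T : ℕ → M)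
    (hbraid : ∀ j, 1 ≤ j → j + 2 ≤ n → T j * T (j + 1) * T j = T (j + 1) * T j * T (j + 1))
    (hcomm : ∀ j k, 1 ≤ j → j + 1 ≤ n → 1 ≤ k → k + 1 ≤ n → (j + 1 < k ∨ k + 1 < j) →
      T j * T k = T k * T j)
    (Θ : ℕ → M) (hΘ : ∀ j, Θ j = descProd T 1 (j - 1) * ascProd T 1 (j - 1)) :
    ∀ i, 1 ≤ i → i ≤ n → descProd Θ 1 i = (descProd T 1 (i - 1)) ^ i := by
  intro i hi
  induction i, hi using Nat.le_induction with
  | base =>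
    intro _
    simp [descProd, ascProd, hΘ]
  | succ i hi ih =>
    intro hin
    obtain ⟨m, rfl⟩ : ∃ m, i = m + 1 := ⟨i - 1, by omega⟩
    rw [descProd_one_succ, ih (by omega), hΘ, Nat.add_sub_cancel, Nat.add_sub_cancel, mul_assoc,
      ← descProd_pow_eq_ascProd_mul hbraid hcomm hin (m + 1) 1 le_rfl (by omega), ← pow_succ']
end

section
/- Let λ = (λ_1,…,λ_r) be a partition. Define T^min_λ : λ^{(∞)} → ℤ≥0 by letting T^min_λ(□) be the number of boxes of λ^{(∞)} lying strictly below □ (in the same column). Then: T^min_λ ∈ Ω(λ); T^min_λ(□) ≤ T(□) for every T ∈ Ω(λ) and every box □ of λ^{(∞)}; deg(T^min_λ) = Σ_{i ≥ 1} i·λ_i; and T^min_λ is the unique element of Ω(λ) of minimal degree. -/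
open scoped Classical

/-- Membership in the infinite diagram `λ^{(∞)}`: an infinite first row atop a copy of
the partition `λ` shifted down by one row. -/
def cellInf (μ : YoungDiagram) : ℕ × ℕ → Prop
  | (0, _) => True
  | (i + 1, j) => (i, j) ∈ μ

/-- Membership in the padded partition `λ^{(n)} = (n − |λ|, λ₁, …, λ_r)`. -/
def cellN (μ : YoungDiagram) (n : ℕ) : ℕ × ℕ → Prop
  | (0, j) => j < n - μ.card
  | (i + 1, j) => (i, j) ∈ μ

/-- `n_λ := |λ| + λ₁`. -/
def nLam (μ : YoungDiagram) : ℕ := μ.card + μ.rowLen 0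

/-- `T ∈ Ω(λ)`: a labelling of `λ^{(∞)}` by non-negative integers, with finitely many
nonzero values, weakly decreasing along rows and strictly decreasing down columns
(normalized to `0` off `λ^{(∞)}`). -/
def IsOmega (μ : YoungDiagram) (T : ℕ × ℕ → ℕ) : Prop :=
  (∀ c, ¬ cellInf μ c → T c = 0) ∧
  {c : ℕ × ℕ | T c ≠ 0}.Finite ∧
  (∀ c : ℕ × ℕ, cellInf μ c → cellInf μ (c.1, c.2 + 1) → T (c.1, c.2 + 1) ≤ T c) ∧
  (∀ c : ℕ × ℕ, cellInf μ c → cellInf μ (c.1 + 1, c.2) → T (c.1 + 1, c.2) < T c)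

/-- The degree `deg(T) = Σ_{□ ∈ λ^{(∞)}} T(□)`. -/
noncomputable def degOmega (T : ℕ × ℕ → ℕ) : ℕ := ∑ᶠ c, T c

/-- The rank `rk(T)`: the least `n ≥ n_λ` such that `T` vanishes on `λ^{(∞)} ∖ λ^{(n)}`. -/
noncomputable def rkOmega (μ : YoungDiagram) (T : ℕ × ℕ → ℕ) : ℕ :=
  sInf {n | nLam μ ≤ n ∧ ∀ c, cellInf μ c → ¬ cellN μ n c → T c = 0}

/-- The labelling `T^min_λ`: each box of `λ^{(∞)}` is labelled by the number of boxes of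
`λ^{(∞)}` lying strictly below it in the same column. -/
noncomputable def Tmin (μ : YoungDiagram) : ℕ × ℕ → ℕ :=
  fun c => if cellInf μ c then
    {c' : ℕ × ℕ | cellInf μ c' ∧ c'.2 = c.2 ∧ c.1 < c'.1}.ncard
  else 0

theorem cellInf_iff_le_colLen (μ : YoungDiagram) (i j : ℕ) :
    cellInf μ (i, j) ↔ i ≤ μ.colLen j := by
  cases i with
  | zero => simp [cellInf]
  | succ i => simp [cellInf, YoungDiagram.mem_iff_lt_colLen]

theorem Tmin_apply (μ : YoungDiagram) (i j : ℕ) : Tmin μ (i, j) = μ.colLen j - i := by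
  have hset : {c : ℕ × ℕ | cellInf μ c ∧ c.2 = j ∧ i < c.1} =
      ((Finset.Ioc i (μ.colLen j)) ×ˢ {j} : Finset (ℕ × ℕ)) := by
    ext ⟨a, b⟩
    simp only [Set.mem_ofPred_eq, cellInf_iff_le_colLen, Finset.mem_coe, Finset.mem_product,
      Finset.mem_Ioc, Finset.mem_singleton]
    constructor
    · rintro ⟨h, rfl, h'⟩
      exact ⟨⟨h', h⟩, rfl⟩
    · rintro ⟨⟨h', h⟩, rfl⟩
      exact ⟨h, rfl, h'⟩
  unfold Tmin
  split_ifs with h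
  · dsimp only
    rw [hset, Set.ncard_coe_finset]
    simp
  · rw [cellInf_iff_le_colLen] at h
    omega

theorem support_Tmin_subset (μ : YoungDiagram) :
    Function.support (Tmin μ) ⊆
      (Finset.range (μ.colLen 0) ×ˢ Finset.range (μ.rowLen 0) : Finset (ℕ × ℕ)) := by
  rintro ⟨i, j⟩ h
  rw [Function.mem_support, Tmin_apply] at h
  have hmem : (i, j) ∈ μ := YoungDiagram.mem_iff_lt_colLen.2 (by omega)
  simp only [Finset.mem_coe, Finset.mem_product, Finset.mem_range]
  exact ⟨YoungDiagram.mem_iff_lt_colLen.1 (μ.up_left_mem le_rfl (Nat.zero_le j) hmem),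
    YoungDiagram.mem_iff_lt_rowLen.1 (μ.up_left_mem (Nat.zero_le i) le_rfl hmem)⟩

theorem isOmega_Tmin (μ : YoungDiagram) : IsOmega μ (Tmin μ) := by
  refine ⟨fun c hc => if_neg hc, (Finset.finite_toSet _).subset (support_Tmin_subset μ), ?_, ?_⟩
  · rintro ⟨i, j⟩ - -
    simp only [Tmin_apply]
    have := μ.colLen_anti j (j + 1) (Nat.le_succ j)
    omega
  · rintro ⟨i, j⟩ - h
    simp only [Tmin_apply, cellInf_iff_le_colLen] at h ⊢
    omega

theorem Tmin_le {μ : YoungDiagram} {T : ℕ × ℕ → ℕ} (hT : IsOmega μ T) (c : ℕ × ℕ) :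
    Tmin μ c ≤ T c := by
  obtain ⟨i, j⟩ := c
  rw [Tmin_apply]
  induction hd : μ.colLen j - i generalizing i with
  | zero => exact Nat.zero_le _
  | succ d ih =>
    have h₁ := ih (i + 1) (by omega)
    have h₂ := hT.2.2.2 (i, j) ((cellInf_iff_le_colLen μ i j).2 (by omega))
      ((cellInf_iff_le_colLen μ (i + 1) j).2 (by omega))
    dsimp only at h₂
    omega

theorem sum_range_tsub_eq_sum_ite {a M : ℕ} (h : a ≤ M) :
    ∑ i ∈ Finset.range M, (a - i) = ∑ k ∈ Finset.range M, if k < a then k + 1 else 0 := by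
  induction M, h using Nat.le_induction with
  | base =>
    rw [← Finset.sum_range_reflect]
    refine Finset.sum_congr rfl fun k hk => ?_
    have := Finset.mem_range.1 hk
    rw [if_pos this]
    omega
  | succ M h ih =>
    rw [Finset.sum_range_succ, Finset.sum_range_succ, ih, if_neg (by omega)]
    omega

theorem degOmega_Tmin (μ : YoungDiagram) :
    degOmega (Tmin μ) = ∑ᶠ i : ℕ, (i + 1) * μ.rowLen i := by
  have hsupp : Function.support (fun i : ℕ => (i + 1) * μ.rowLen i) ⊆
      (Finset.range (μ.colLen 0) : Finset ℕ) := by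
    intro i hi
    have hpos : 0 < μ.rowLen i := Nat.pos_of_ne_zero fun h => hi (by simp [h])
    simpa using YoungDiagram.mem_iff_lt_colLen.1 (YoungDiagram.mem_iff_lt_rowLen.2 hpos)
  rw [degOmega, finsum_eq_sum_of_support_subset _ (support_Tmin_subset μ),
    finsum_eq_sum_of_support_subset _ hsupp, Finset.sum_product_right]
  simp only [Tmin_apply]
  rw [Finset.sum_congr rfl fun j _ =>
    sum_range_tsub_eq_sum_ite (μ.colLen_anti 0 j (Nat.zero_le j)), Finset.sum_comm]
  refine Finset.sum_congr rfl fun k _ => ?_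
  have hfilter : (Finset.range (μ.rowLen 0)).filter (fun j => k < μ.colLen j) =
      Finset.range (μ.rowLen k) := by
    ext j
    have := μ.rowLen_anti 0 k (Nat.zero_le k)
    rw [Finset.mem_filter, Finset.mem_range, Finset.mem_range,
      ← YoungDiagram.mem_iff_lt_colLen, YoungDiagram.mem_iff_lt_rowLen]
    omega
  rw [← Finset.sum_filter, hfilter, Finset.sum_const, Finset.card_range, smul_eq_mul, mul_comm]

theorem degOmega_mono {S T : ℕ × ℕ → ℕ} (hT : (Function.support T).Finite)
    (h : ∀ c, S c ≤ T c) : degOmega S ≤ degOmega T := by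
  have hTs : Function.support T ⊆ (hT.toFinset : Set (ℕ × ℕ)) := by simp
  have hSs : Function.support S ⊆ (hT.toFinset : Set (ℕ × ℕ)) := fun c hc =>
    hTs fun h0 => hc (Nat.le_zero.1 (h0 ▸ h c))
  rw [degOmega, degOmega, finsum_eq_sum_of_support_subset _ hTs,
    finsum_eq_sum_of_support_subset _ hSs]
  exact Finset.sum_le_sum fun c _ => h c

theorem eq_of_le_of_degOmega_eq {S T : ℕ × ℕ → ℕ} (hT : (Function.support T).Finite)
    (h : ∀ c, S c ≤ T c) (hdeg : degOmega T = degOmega S) : T = S := by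
  have hTs : Function.support T ⊆ (hT.toFinset : Set (ℕ × ℕ)) := by simp
  have hSs : Function.support S ⊆ (hT.toFinset : Set (ℕ × ℕ)) := fun c hc =>
    hTs fun h0 => hc (Nat.le_zero.1 (h0 ▸ h c))
  rw [degOmega, degOmega, finsum_eq_sum_of_support_subset _ hTs,
    finsum_eq_sum_of_support_subset _ hSs] at hdeg
  have heq := (Finset.sum_eq_sum_iff_of_le fun c _ => h c).1 hdeg.symm
  funext c
  by_cases hc : c ∈ hT.toFinset
  · exact (heq c hc).symm
  · rw [Function.notMem_support.1 fun hs => hc (hTs hs),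
      Function.notMem_support.1 fun hs => hc (hSs hs)]

/-- `T^min_λ ∈ Ω(λ)`; it is a pointwise lower bound for every
`T ∈ Ω(λ)`; its degree is `d_λ = Σ_{i ≥ 1} i·λ_i`; and it is the unique element of
`Ω(λ)` of minimal degree. -/
theorem statement8 (μ : YoungDiagram) :
    IsOmega μ (Tmin μ) ∧
    (∀ T, IsOmega μ T → ∀ c, Tmin μ c ≤ T c) ∧
    degOmega (Tmin μ) = ∑ᶠ i : ℕ, (i + 1) * μ.rowLen i ∧
    (∀ T, IsOmega μ T → degOmega (Tmin μ) ≤ degOmega T) ∧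
    (∀ T, IsOmega μ T → degOmega T = degOmega (Tmin μ) → T = Tmin μ) := by
  exact ⟨isOmega_Tmin μ, fun _ hT => Tmin_le hT, degOmega_Tmin μ,
    fun _ hT => degOmega_mono hT.2.1 (Tmin_le hT),
    fun _ hT => eq_of_le_of_degOmega_eq hT.2.1 (Tmin_le hT)⟩
end

section
/- Let λ be a partition of n, T ∈ RSSYT(λ), τ ∈ PSYT(λ;T), and (□_1, □_2) ∈ Inv(τ) an inversion pair with T(□_1) = T(□_2). Then c(□_2) − c(□_1) ≥ 2. -/
open scoped Classical

theorem labelLT.trans {x y z : ℕ × ℕ} (hxy : labelLT x y) (hyz : labelLT y z) :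
    labelLT x z := by
  unfold labelLT at *
  omega

/-- Labels of a periodic standard Young tableau strictly increase along rows. -/
theorem IsPSYT.labelLT_row {μ : YoungDiagram} {τ : ℕ × ℕ → ℕ × ℕ} (hτ : IsPSYT μ.cells τ)
    {i j k : ℕ} (hjk : j < k) (hk : (i, k) ∈ μ.cells) : labelLT (τ (i, j)) (τ (i, k)) := by
  induction k, hjk using Nat.le_induction with
  | base => exact hτ.2.1 _ (μ.isLowerSet (Prod.mk_le_mk.2 ⟨le_rfl, j.le_succ⟩) hk) _ hk rfl rfl
  | succ k _ ih =>
    have hk' : (i, k) ∈ μ.cells := μ.isLowerSet (Prod.mk_le_mk.2 ⟨le_rfl, k.le_succ⟩) hk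
    exact (ih hk').trans (hτ.2.1 _ hk' _ hk rfl rfl)

/-- Entries of a reverse semi-standard Young tableau weakly decrease along rows. -/
theorem IsRSSYT.row_anti {μ : YoungDiagram} {T : ℕ × ℕ → ℕ} (hT : IsRSSYT μ.cells T)
    {i j k : ℕ} (hjk : j ≤ k) (hk : (i, k) ∈ μ.cells) : T (i, k) ≤ T (i, j) := by
  induction k, hjk using Nat.le_induction with
  | base => exact le_rfl
  | succ k _ ih =>
    have hk' : (i, k) ∈ μ.cells := μ.isLowerSet (Prod.mk_le_mk.2 ⟨le_rfl, k.le_succ⟩) hk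
    exact (hT.1 _ hk' _ hk rfl rfl).trans (ih hk')

/-- Entries of a reverse semi-standard Young tableau strictly decrease down columns. -/
theorem IsRSSYT.col_strictAnti {μ : YoungDiagram} {T : ℕ × ℕ → ℕ} (hT : IsRSSYT μ.cells T)
    {i k j : ℕ} (hik : i < k) (hk : (k, j) ∈ μ.cells) : T (k, j) < T (i, j) := by
  induction k, hik using Nat.le_induction with
  | base => exact hT.2.1 _ (μ.isLowerSet (Prod.mk_le_mk.2 ⟨i.le_succ, le_rfl⟩) hk) _ hk rfl rfl
  | succ k _ ih =>
    have hk' : (k, j) ∈ μ.cells := μ.isLowerSet (Prod.mk_le_mk.2 ⟨k.le_succ, le_rfl⟩) hk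
    exact (hT.2.1 _ hk' _ hk rfl rfl).trans (ih hk')

/-- Let `λ` be a partition of `n`, `T ∈ RSSYT(λ)`, `τ ∈ PSYT(λ;T)`, and
`(□₁, □₂) ∈ Inv(τ)` an inversion pair with `T □₁ = T □₂`. Then `c(□₂) − c(□₁) ≥ 2`. -/
theorem statement9 (μ : YoungDiagram) (n : ℕ) (hn : μ.card = n)
    (T : ℕ × ℕ → ℕ) (hT : IsRSSYT μ.cells T)
    (τ : ℕ × ℕ → ℕ × ℕ) (hτ : InFiber μ.cells T τ) (c1 c2 : ℕ × ℕ)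
    (hinv : (c1, c2) ∈ invSet μ.cells T τ) (heq : T c1 = T c2) :
    2 ≤ content c2 - content c1 := by
  obtain ⟨i, j⟩ := c1
  obtain ⟨k, l⟩ := c2
  simp only [invSet, Finset.mem_filter, Finset.mem_product] at hinv
  obtain ⟨⟨h1, h2⟩, hlt, hnum⟩ := hinv
  have hread : j < l ∨ (j = l ∧ i < k) := hlt.elim (fun h => absurd heq h.ne') (·.2)
  have hjl : j ≤ l := by omega
  have hki : k ≤ i := by
    by_contra! hik
    have hil : (i, l) ∈ μ.cells := μ.isLowerSet (Prod.mk_le_mk.2 ⟨hik.le, le_rfl⟩) h2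
    have hrow := hT.row_anti hjl hil
    have hcol := hT.col_strictAnti hik h2
    omega
  have hne : k ≠ i := by
    rintro rfl
    have hlab := hτ.1.labelLT_row (by omega : j < l) h2
    have e1 := hτ.2 _ h1
    have e2 := hτ.2 _ h2
    unfold labelLT at hlab
    omega
  simp only [content]
  omega
end

section
/- Let λ be a partition of n, T ∈ RSSYT(λ), and □_0 a T-raisable box of λ. Then there is exactly one τ ∈ PSYT(λ;T) such that the number 1 labels the box □_0 (i.e. τ(□_0) = 1q^{T(□_0)}) and inv(τ) = S(T)(□_0) − 1. -/
open scoped Classical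

/-- The labelling obtained from `T` by raising the value of the box `c0` by one. -/
def raiseAt (T : ℕ × ℕ → ℕ) (c0 : ℕ × ℕ) : ℕ × ℕ → ℕ :=
  fun c => if c = c0 then T c + 1 else T c

/-- `S(T)(□)`: the position (from `1` to `n`) of the box `□` in the total order `<_T`. -/
noncomputable def rankS (s : Finset (ℕ × ℕ)) (T : ℕ × ℕ → ℕ) (c0 : ℕ × ℕ) : ℕ :=
  (s.filter fun c' => boxLT T c' c0).card + 1

/-- A map from `s` to `ℕ` hitting each of `1, …, |s|` maps `s` bijectively onto them. -/
theorem image_eq_Icc_and_injOn {α : Type*} {s : Finset α} {f : α → ℕ}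
    (hf : ∀ j, 1 ≤ j → j ≤ s.card → ∃! c, c ∈ s ∧ f c = j) :
    s.image f = Finset.Icc 1 s.card ∧ Set.InjOn f s := by
  have hsub : Finset.Icc 1 s.card ⊆ s.image f := by
    intro j hj
    rw [Finset.mem_Icc] at hj
    obtain ⟨c, hc, -⟩ := hf j hj.1 hj.2
    exact Finset.mem_image.2 ⟨c, hc⟩
  have himage : Finset.Icc 1 s.card = s.image f :=
    Finset.eq_of_subset_of_card_le hsub (by simpa using Finset.card_image_le)
  refine ⟨himage.symm, Finset.card_image_iff.1 ?_⟩
  simp [← himage]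

/-- A labelling of `s` by `1, …, |s|` which is compatible with a relation `r` sends each
element to its position with respect to `r`. -/
theorem eq_card_filter_add_one {α : Type*} {s : Finset α} {f : α → ℕ} {r : α → α → Prop}
    (hf : ∀ j, 1 ≤ j → j ≤ s.card → ∃! c, c ∈ s ∧ f c = j)
    (hr : ∀ c ∈ s, ∀ d ∈ s, f c < f d ↔ r c d) {c : α} (hc : c ∈ s) :
    f c = (s.filter fun d => r d c).card + 1 := by
  obtain ⟨himage, hinj⟩ := image_eq_Icc_and_injOn hf
  have hbd : 1 ≤ f c ∧ f c ≤ s.card := by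
    rw [← Finset.mem_Icc, ← himage]
    exact Finset.mem_image_of_mem f hc
  have hcard : (s.filter fun d => r d c).image f = Finset.Ico 1 (f c) := by
    ext j
    simp only [Finset.mem_image, Finset.mem_filter, Finset.mem_Ico]
    constructor
    · rintro ⟨d, ⟨hd, hdc⟩, rfl⟩
      have : f d ∈ Finset.Icc 1 s.card := himage ▸ Finset.mem_image_of_mem f hd
      exact ⟨(Finset.mem_Icc.1 this).1, (hr d hd c hc).2 hdc⟩
    · rintro ⟨h1, h2⟩
      obtain ⟨d, ⟨hd, rfl⟩, -⟩ := hf j h1 (h2.le.trans hbd.2)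
      exact ⟨d, ⟨hd, (hr d hd c hc).1 h2⟩, rfl⟩
  have hcard' := congrArg Finset.card hcard
  rw [Finset.card_image_of_injOn (hinj.mono fun d hd => (Finset.mem_filter.1 hd).1), Nat.card_Ico] at hcard'
  omega

/-- Positions with respect to a strict order are strictly monotone. -/
theorem card_filter_lt_card_filter {α : Type*} {s : Finset α} {r : α → α → Prop}
    (hirr : ∀ a, ¬ r a a) (htrans : ∀ a b c, r a b → r b c → r a c)
    {c d : α} (hc : c ∈ s) (hcd : r c d) :
    (s.filter fun b => r b c).card < (s.filter fun b => r b d).card := by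
  refine Finset.card_lt_card ((Finset.ssubset_iff_of_subset ?_).2 ⟨c, ?_, ?_⟩)
  · exact Finset.monotone_filter_right s fun b _ hb => htrans b c d hb hcd
  · simp [hc, hcd]
  · simp [hirr]

/-- The positions with respect to a strict total order are exactly `1, …, |s|`. -/
theorem existsUnique_card_filter_add_one {α : Type*} {s : Finset α} {r : α → α → Prop}
    (hirr : ∀ a, ¬ r a a) (htrans : ∀ a b c, r a b → r b c → r a c)
    (htri : ∀ a b, a ≠ b → r a b ∨ r b a) (j : ℕ) (h1 : 1 ≤ j) (hj : j ≤ s.card) :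
    ∃! c, c ∈ s ∧ (s.filter fun b => r b c).card + 1 = j := by
  have hinj : Set.InjOn (fun c => (s.filter fun b => r b c).card + 1) s := by
    intro c hc d hd h
    by_contra hne
    have h' : (s.filter fun b => r b c).card + 1 = (s.filter fun b => r b d).card + 1 := h
    rcases htri c d hne with hlt | hlt
    · have := card_filter_lt_card_filter hirr htrans hc hlt
      omega
    · have := card_filter_lt_card_filter hirr htrans hd hlt
      omega
  have himage : s.image (fun c => (s.filter fun b => r b c).card + 1) =
      Finset.Icc 1 s.card := by
    refine Finset.eq_of_subset_of_card_le ?_ ?_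
    · intro i hi
      obtain ⟨c, hc, rfl⟩ := Finset.mem_image.1 hi
      have : (s.filter fun b => r b c).card < s.card :=
        Finset.card_lt_card (Finset.filter_ssubset.2 ⟨c, hc, hirr c⟩)
      exact Finset.mem_Icc.2 ⟨by omega, by omega⟩
    · simp [Finset.card_image_of_injOn hinj]
  have hmem : j ∈ Finset.Icc 1 s.card := Finset.mem_Icc.2 ⟨h1, hj⟩
  rw [← himage] at hmem
  obtain ⟨c, hc, hcj⟩ := Finset.mem_image.1 hmem
  exact ⟨c, ⟨hc, hcj⟩, fun d hd => hinj hd.1 hc (hd.2.trans hcj.symm)⟩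

theorem boxLT_irrefl (T : ℕ × ℕ → ℕ) (a : ℕ × ℕ) : ¬ boxLT T a a := by
  simp [boxLT, colReadLT]

theorem boxLT_trans {T : ℕ × ℕ → ℕ} {a b c : ℕ × ℕ} (hab : boxLT T a b)
    (hbc : boxLT T b c) : boxLT T a c := by
  unfold boxLT colReadLT at *
  omega

theorem boxLT_or_boxLT_of_ne (T : ℕ × ℕ → ℕ) {a b : ℕ × ℕ} (h : a ≠ b) :
    boxLT T a b ∨ boxLT T b a := by
  rw [Ne, Prod.ext_iff] at h
  unfold boxLT colReadLT
  omega

/-- The order `<_T` modified by moving the box `c0` to the first place. -/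
def boxLTFirst (T : ℕ × ℕ → ℕ) (c0 c d : ℕ × ℕ) : Prop :=
  d ≠ c0 ∧ (c = c0 ∨ boxLT T c d)

theorem boxLTFirst_irrefl (T : ℕ × ℕ → ℕ) (c0 a : ℕ × ℕ) : ¬ boxLTFirst T c0 a a := by
  rintro ⟨h, h' | h'⟩
  · exact h h'
  · exact boxLT_irrefl T a h'

theorem boxLTFirst_trans (T : ℕ × ℕ → ℕ) (c0 a b c : ℕ × ℕ) (hab : boxLTFirst T c0 a b)
    (hbc : boxLTFirst T c0 b c) : boxLTFirst T c0 a c :=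
  ⟨hbc.1, hab.2.imp_right fun h => boxLT_trans h (hbc.2.resolve_left hab.1)⟩

theorem boxLTFirst_total (T : ℕ × ℕ → ℕ) (c0 a b : ℕ × ℕ) (h : a ≠ b) :
    boxLTFirst T c0 a b ∨ boxLTFirst T c0 b a := by
  by_cases ha : a = c0
  · exact Or.inl ⟨fun hb => h (ha.trans hb.symm), Or.inl ha⟩
  by_cases hb : b = c0
  · exact Or.inr ⟨ha, Or.inl hb⟩
  exact (boxLT_or_boxLT_of_ne T h).imp (fun h => ⟨hb, Or.inr h⟩) fun h => ⟨ha, Or.inr h⟩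

/-- The labelling with `q`-exponents `T` that numbers `c0` by `1` and the other boxes by
`2, …, n` in the order `<_T`. -/
noncomputable def firstTab (s : Finset (ℕ × ℕ)) (T : ℕ × ℕ → ℕ) (c0 : ℕ × ℕ) :
    ℕ × ℕ → ℕ × ℕ :=
  fun c => if c ∈ s then ((s.filter fun d => boxLTFirst T c0 d c).card + 1, T c) else (0, 0)

theorem firstTab_of_mem {s : Finset (ℕ × ℕ)} (T : ℕ × ℕ → ℕ) (c0 : ℕ × ℕ) {c : ℕ × ℕ}
    (hc : c ∈ s) :
    firstTab s T c0 c = ((s.filter fun d => boxLTFirst T c0 d c).card + 1, T c) :=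
  if_pos hc

theorem firstTab_fst_lt_iff {s : Finset (ℕ × ℕ)} (T : ℕ × ℕ → ℕ) (c0 : ℕ × ℕ)
    {c d : ℕ × ℕ} (hc : c ∈ s) (hd : d ∈ s) :
    (firstTab s T c0 c).1 < (firstTab s T c0 d).1 ↔ boxLTFirst T c0 c d := by
  have key {a b : ℕ × ℕ} (ha : a ∈ s) (h : boxLTFirst T c0 a b) :=
    card_filter_lt_card_filter (boxLTFirst_irrefl T c0) (boxLTFirst_trans T c0) ha h
  rw [firstTab_of_mem T c0 hc, firstTab_of_mem T c0 hd, Nat.add_lt_add_iff_right]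
  refine ⟨fun h => ?_, key hc⟩
  by_contra hcd
  by_cases hne : c = d
  · simp [hne] at h
  · exact h.asymm (key hd ((boxLTFirst_total T c0 c d hne).resolve_left hcd))

theorem firstTab_self {s : Finset (ℕ × ℕ)} (T : ℕ × ℕ → ℕ) {c0 : ℕ × ℕ} (hc0 : c0 ∈ s) :
    (firstTab s T c0 c0).1 = 1 := by
  simp [firstTab_of_mem T c0 hc0, boxLTFirst]

theorem firstTab_inFiber {s : Finset (ℕ × ℕ)} {T : ℕ × ℕ → ℕ} {c0 : ℕ × ℕ}
    (hT : IsRSSYT s T) (hraise : IsRSSYT s (raiseAt T c0)) :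
    InFiber s T (firstTab s T c0) := by
  refine ⟨⟨fun j h1 hj => ?_, fun c hc d hd hrow hcol => ?_,
    fun c hc d hd hrow hcol => Or.inl ?_, fun c hc => if_neg hc⟩, fun c hc => ?_⟩
  · obtain ⟨c, ⟨hc, hcj⟩, huniq⟩ := existsUnique_card_filter_add_one
      (boxLTFirst_irrefl T c0) (boxLTFirst_trans T c0) (boxLTFirst_total T c0) j h1 hj
    refine ⟨c, ⟨hc, by rw [firstTab_of_mem T c0 hc, hcj]⟩, fun d hd => huniq d ⟨hd.1, ?_⟩⟩
    have hdj := hd.2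
    rwa [firstTab_of_mem T c0 hd.1] at hdj
  · unfold labelLT
    rw [firstTab_fst_lt_iff T c0 hc hd, firstTab_of_mem T c0 hc, firstTab_of_mem T c0 hd]
    rcases (hT.1 c hc d hd hrow hcol).lt_or_eq with h | h
    · exact Or.inl h
    refine Or.inr ⟨h.symm, ?_, Or.inr (Or.inr ⟨h.symm, Or.inl (by omega)⟩)⟩
    rintro rfl
    have hne : c ≠ d := by
      rintro rfl
      omega
    have := hraise.1 c hc d hd hrow hcol
    simp only [raiseAt, if_neg hne, if_true] at this
    omega
  · rw [firstTab_of_mem T c0 hc, firstTab_of_mem T c0 hd]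
    exact hT.2.1 c hc d hd hrow hcol
  · rw [firstTab_of_mem T c0 hc]

/-- The pairs `(b, c0)` with `b <_T c0` are counted by `S(T)(c0) - 1`. -/
theorem card_image_boxLT_pair (s : Finset (ℕ × ℕ)) (T : ℕ × ℕ → ℕ) (c0 : ℕ × ℕ) :
    ((s.filter fun b => boxLT T b c0).image fun b => (b, c0)).card = rankS s T c0 - 1 := by
  rw [Finset.card_image_of_injective _ fun a b h => congrArg Prod.fst h]
  rfl

theorem invNum_firstTab {s : Finset (ℕ × ℕ)} (T : ℕ × ℕ → ℕ) {c0 : ℕ × ℕ} (hc0 : c0 ∈ s) :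
    invNum s T (firstTab s T c0) = rankS s T c0 - 1 := by
  rw [← card_image_boxLT_pair, invNum]
  congr 1
  ext ⟨b, c⟩
  simp only [invSet, Finset.mem_filter, Finset.mem_product, Finset.mem_image, Prod.mk.injEq]
  constructor
  · rintro ⟨⟨hb, hc⟩, hbc, hlt⟩
    rw [firstTab_fst_lt_iff T c0 hc hb] at hlt
    rcases hlt.2 with rfl | h
    · exact ⟨b, ⟨hb, hbc⟩, rfl, rfl⟩
    · exact (boxLT_irrefl T b (boxLT_trans hbc h)).elim
  · rintro ⟨b, ⟨hb, hbc⟩, rfl, rfl⟩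
    refine ⟨⟨hb, hc0⟩, hbc, (firstTab_fst_lt_iff T c0 hc0 hb).2 ⟨?_, Or.inl rfl⟩⟩
    rintro rfl
    exact boxLT_irrefl T _ hbc

theorem eq_firstTab {s : Finset (ℕ × ℕ)} {T : ℕ × ℕ → ℕ} {c0 : ℕ × ℕ} (hc0 : c0 ∈ s)
    {τ : ℕ × ℕ → ℕ × ℕ} (hτ : InFiber s T τ) (hone : (τ c0).1 = 1)
    (hinv : invNum s T τ = rankS s T c0 - 1) : τ = firstTab s T c0 := by
  obtain ⟨himage, hinj⟩ := image_eq_Icc_and_injOn (f := fun c => (τ c).1) hτ.1.1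
  have hfirst : ∀ c ∈ s, c ≠ c0 → (τ c0).1 < (τ c).1 := by
    intro c hc hne
    have hmem : (τ c).1 ∈ Finset.Icc 1 s.card :=
      himage ▸ Finset.mem_image_of_mem (fun c => (τ c).1) hc
    have hne' : (τ c).1 ≠ (τ c0).1 := fun h => hne (hinj hc hc0 h)
    have := (Finset.mem_Icc.1 hmem).1
    omega
  have hsub : ((s.filter fun b => boxLT T b c0).image fun b => (b, c0)) ⊆ invSet s T τ := by
    intro p hp
    obtain ⟨b, hb, rfl⟩ := Finset.mem_image.1 hp
    obtain ⟨hb, hlt⟩ := Finset.mem_filter.1 hb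
    refine Finset.mem_filter.2 ⟨Finset.mk_mem_product hb hc0, hlt, hfirst b hb ?_⟩
    rintro rfl
    exact boxLT_irrefl T _ hlt
  have heq := Finset.eq_of_subset_of_card_le hsub (by
    rw [card_image_boxLT_pair, ← hinv, invNum])
  have hmono : ∀ c ∈ s, ∀ d ∈ s, boxLTFirst T c0 c d → (τ c).1 < (τ d).1 := by
    rintro c hc d hd ⟨hd0, rfl | hlt⟩
    · exact hfirst d hd hd0
    refine lt_of_le_of_ne (not_lt.1 fun hgt => ?_) fun h => ?_
    · have hmem : (c, d) ∈ invSet s T τ :=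
        Finset.mem_filter.2 ⟨Finset.mk_mem_product hc hd, hlt, hgt⟩
      rw [← heq] at hmem
      obtain ⟨b, -, hb⟩ := Finset.mem_image.1 hmem
      exact hd0 (congrArg Prod.snd hb).symm
    · obtain rfl := hinj hc hd h
      exact boxLT_irrefl T _ hlt
  have hiff : ∀ c ∈ s, ∀ d ∈ s, (τ c).1 < (τ d).1 ↔ boxLTFirst T c0 c d := by
    refine fun c hc d hd => ⟨fun h => ?_, hmono c hc d hd⟩
    have hne : c ≠ d := by
      rintro rfl
      exact lt_irrefl _ h
    exact (boxLTFirst_total T c0 c d hne).resolve_right fun h' => h.asymm (hmono d hd c hc h')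
  funext c
  by_cases hc : c ∈ s
  · rw [firstTab_of_mem T c0 hc]
    exact Prod.ext (eq_card_filter_add_one (f := fun c => (τ c).1) hτ.1.1 hiff hc) (hτ.2 c hc)
  · rw [hτ.1.2.2.2 c hc, firstTab, if_neg hc]

/-- Let `λ` be a partition of `n`, `T ∈ RSSYT(λ)`, and `□₀` a
`T`-raisable box of `λ`. Then there is exactly one `τ ∈ PSYT(λ;T)` such that the number
`1` labels the box `□₀` and `inv(τ) = S(T)(□₀) − 1`. -/
theorem statement10 (μ : YoungDiagram) (n : ℕ) (hn : μ.card = n)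
    (T : ℕ × ℕ → ℕ) (hT : IsRSSYT μ.cells T)
    (c0 : ℕ × ℕ) (hc0 : c0 ∈ μ.cells) (hraise : IsRSSYT μ.cells (raiseAt T c0)) :
    ∃! τ : ℕ × ℕ → ℕ × ℕ, InFiber μ.cells T τ ∧ (τ c0).1 = 1 ∧
      invNum μ.cells T τ = rankS μ.cells T c0 - 1 := by
  exact ⟨firstTab μ.cells T c0,
    ⟨firstTab_inFiber hT hraise, firstTab_self T hc0, invNum_firstTab T hc0⟩,
    fun τ hτ => eq_firstTab hc0 hτ.1 hτ.2.1 hτ.2.2⟩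
end
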